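/- arXiv:2405.11701 — 16 statements merged into one kernel-verified Lean document; each statement's English description precedes it below -/
import Mathlib

section
/- Let λ ∈ (0,1), let I ⊆ ℝ be an interval, let f : ℝ → ℝ be convex on I and continuous on the segment joining a and b, where a, b ∈ I. Then f((1-λ)a + λb) ≤ ∫₀¹ f((1-t)a + tb)·(λ/(1-λ))·t^((2λ-1)/(1-λ)) dt ≤ (1-λ)f(a) + λf(b). -/
/-- A convex function on a set of reals has a supporting line at every interior point. -/
theorem ConvexOn.exists_supporting_line_of_mem_interior {S : Set ℝ} {g : ℝ → ℝ} {x : ℝ}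
    (hg : ConvexOn ℝ S g) (hx : x ∈ interior S) :
    ∃ m : ℝ, ∀ y ∈ S, g x + m * (y - x) ≤ g y := by
  refine ⟨derivWithin g (Set.Ioi x) x, fun y hy => ?_⟩
  have hxS : x ∈ S := interior_subset hx
  rcases lt_trichotomy y x with h | rfl | h
  · have h₁ := hg.slope_le_leftDeriv_of_mem_interior hy hx h
    have h₂ := hg.leftDeriv_le_rightDeriv_of_mem_interior hx
    have h₃ := h₁.trans h₂
    rw [slope_def_field, div_le_iff₀ (sub_pos.2 h)] at h₃
    linarith
  · simp
  · have h₁ := hg.rightDeriv_le_slope_of_mem_interior hx hy h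
    rw [slope_def_field, le_div_iff₀ (sub_pos.2 h)] at h₁
    linarith

/-- The integral of an affine function against the power weight `c * t ^ (c - 1)` on `[0, 1]`. -/
theorem integral_affine_mul_rpow_weight {c : ℝ} (hc : 0 < c) (p q : ℝ) :
    ∫ t in (0 : ℝ)..1, (p + q * t) * (c * t ^ (c - 1)) = p + q * (c / (c + 1)) := by
  have hI₀ : IntervalIntegrable (fun t : ℝ => p * c * t ^ (c - 1)) MeasureTheory.volume 0 1 :=
    (intervalIntegral.intervalIntegrable_rpow' (by linarith)).const_mul _
  have hI₁ : IntervalIntegrable (fun t : ℝ => q * c * t ^ c) MeasureTheory.volume 0 1 :=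
    (intervalIntegral.intervalIntegrable_rpow' (by linarith)).const_mul _
  have hsplit : ∫ t in (0 : ℝ)..1, (p + q * t) * (c * t ^ (c - 1)) =
      ∫ t in (0 : ℝ)..1, (p * c * t ^ (c - 1) + q * c * t ^ c) := by
    refine intervalIntegral.integral_congr_Ioo_of_le zero_le_one fun t ht => ?_
    have : t ^ c = t * t ^ (c - 1) := by
      rw [Real.rpow_sub_one ht.1.ne']
      field_simp [ht.1.ne']
    simp only [this]
    ring
  rw [hsplit, intervalIntegral.integral_add hI₀ hI₁, intervalIntegral.integral_const_mul,
    intervalIntegral.integral_const_mul, integral_rpow (Or.inl (by linarith)),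
    integral_rpow (Or.inl (by linarith)), Real.one_rpow, Real.one_rpow,
    Real.zero_rpow (by linarith), Real.zero_rpow (by linarith)]
  have : c + 1 ≠ 0 := by linarith
  simp only [sub_add_cancel]
  field_simp
  ring

/-- Scalar weighted Hermite–Hadamard inequality: for `λ ∈ (0,1)`, a convex function `f`
on an interval `I` containing `a, b`, continuous on the segment joining them,
`f(a∇_λ b) ≤ ∫₀¹ f(a∇_t b) dη_λ(t) ≤ f(a)∇_λ f(b)`. -/
theorem stmt_1 (l : ℝ) (hl : l ∈ Set.Ioo (0 : ℝ) 1) (I : Set ℝ) (hI : Convex ℝ I)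
    (f : ℝ → ℝ) (hf : ConvexOn ℝ I f) (a b : ℝ) (ha : a ∈ I) (hb : b ∈ I)
    (hcont : ContinuousOn f (segment ℝ a b)) :
    f ((1 - l) * a + l * b) ≤
      (∫ t in (0 : ℝ)..1, f ((1 - t) * a + t * b) * (l / (1 - l) * t ^ ((2 * l - 1) / (1 - l)))) ∧
    (∫ t in (0 : ℝ)..1, f ((1 - t) * a + t * b) * (l / (1 - l) * t ^ ((2 * l - 1) / (1 - l)))) ≤
      (1 - l) * f a + l * f b := by
  obtain ⟨hl0, hl1⟩ := hl
  have hl1' : 0 < 1 - l := sub_pos.2 hl1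
  set c := l / (1 - l) with hc_def
  have hc : 0 < c := div_pos hl0 hl1'
  have hexp : (2 * l - 1) / (1 - l) = c - 1 := by
    rw [hc_def]
    field_simp
    ring
  have hmean : c / (c + 1) = l := by
    rw [hc_def]
    field_simp
    ring
  rw [hexp]
  set g : ℝ → ℝ := fun t => f ((1 - t) * a + t * b) with hg_def
  have hmem : ∀ t ∈ Set.Icc (0 : ℝ) 1, (1 - t) * a + t * b ∈ segment ℝ a b := fun t ht =>
    ⟨1 - t, t, sub_nonneg.2 ht.2, ht.1, by ring, rfl⟩
  have hgcont : ContinuousOn g (Set.Icc 0 1) :=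
    hcont.comp (by fun_prop) hmem
  have hgconv : ConvexOn ℝ (Set.Icc 0 1) g := by
    have h := (hf.comp_affineMap (AffineMap.lineMap a b : ℝ →ᵃ[ℝ] ℝ)).subset
      (s := Set.Icc 0 1) (fun t ht => ?_) (convex_Icc 0 1)
    · exact h.congr fun t _ => by simp [hg_def, AffineMap.lineMap_apply_ring]
    · simpa [AffineMap.lineMap_apply_ring] using hI.segment_subset ha hb (hmem t ht)
  have hwint : IntervalIntegrable (fun t : ℝ => c * t ^ (c - 1)) MeasureTheory.volume 0 1 :=
    (intervalIntegral.intervalIntegrable_rpow' (by linarith)).const_mul _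
  have hint : ∀ h : ℝ → ℝ, ContinuousOn h (Set.Icc 0 1) →
      IntervalIntegrable (fun t => h t * (c * t ^ (c - 1))) MeasureTheory.volume 0 1 :=
    fun h hh => hwint.continuousOn_mul (by rwa [Set.uIcc_of_le zero_le_one])
  have hw : ∀ t ∈ Set.Icc (0 : ℝ) 1, 0 ≤ c * t ^ (c - 1) := fun t ht =>
    mul_nonneg hc.le (Real.rpow_nonneg ht.1 _)
  constructor
  · obtain ⟨m, hm⟩ := hgconv.exists_supporting_line_of_mem_interior (x := l)
      (by rw [interior_Icc]; exact ⟨hl0, hl1⟩)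
    calc g l = ∫ t in (0 : ℝ)..1, (g l - m * l + m * t) * (c * t ^ (c - 1)) := by
          rw [integral_affine_mul_rpow_weight hc, hmean]
          ring
      _ ≤ ∫ t in (0 : ℝ)..1, g t * (c * t ^ (c - 1)) := by
          refine intervalIntegral.integral_mono_on zero_le_one (hint _ (by fun_prop))
            (hint _ hgcont) fun t ht => mul_le_mul_of_nonneg_right ?_ (hw t ht)
          linarith [hm t ht]
  · calc ∫ t in (0 : ℝ)..1, g t * (c * t ^ (c - 1))
        ≤ ∫ t in (0 : ℝ)..1, (f a + (f b - f a) * t) * (c * t ^ (c - 1)) := by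
          refine intervalIntegral.integral_mono_on zero_le_one (hint _ hgcont)
            (hint _ (by fun_prop)) fun t ht => mul_le_mul_of_nonneg_right ?_ (hw t ht)
          have h := hf.2 ha hb (sub_nonneg.2 ht.2) ht.1 (sub_add_cancel 1 t)
          simp only [smul_eq_mul] at h
          linarith
      _ = (1 - l) * f a + l * f b := by
          rw [integral_affine_mul_rpow_weight hc, hmean]
          ring
end

section
/- For every x ∈ (0,∞) and y ∈ [2,∞), the beta integral B(x,y) = ∫₀¹ t^(x-1)·(1-t)^(y-1) dt satisfies 1/(x·(1+x)^(y-1)) ≤ B(x,y) ≤ 1/(x·(1+x)). -/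
theorem rpow_sub_one_mul_affine {x : ℝ} (hx : 0 < x) (a b : ℝ) {t : ℝ} (ht : 0 ≤ t) :
    t ^ (x - 1) * (a + b * t) = a * t ^ (x - 1) + b * t ^ x := by
  have h : t ^ (x - 1) * t = t ^ x := by
    rw [← Real.rpow_add_one' ht (by linarith), sub_add_cancel]
  rw [← h]
  ring

theorem intervalIntegrable_rpow_sub_one_mul_affine {x : ℝ} (hx : 0 < x) (a b : ℝ) :
    IntervalIntegrable (fun t : ℝ => t ^ (x - 1) * (a + b * t)) MeasureTheory.volume 0 1 :=
  (intervalIntegral.intervalIntegrable_rpow' (by linarith)).mul_continuousOn (by fun_prop)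

theorem integral_rpow_sub_one_mul_affine {x : ℝ} (hx : 0 < x) (a b : ℝ) :
    ∫ t in (0 : ℝ)..1, t ^ (x - 1) * (a + b * t) = a / x + b / (x + 1) := by
  have hcongr : ∫ t in (0 : ℝ)..1, t ^ (x - 1) * (a + b * t) =
      ∫ t in (0 : ℝ)..1, (a * t ^ (x - 1) + b * t ^ x) := by
    refine intervalIntegral.integral_congr fun t ht => ?_
    rw [Set.uIcc_of_le zero_le_one] at ht
    exact rpow_sub_one_mul_affine hx a b ht.1
  rw [hcongr, intervalIntegral.integral_add
      ((intervalIntegral.intervalIntegrable_rpow' (by linarith)).const_mul a)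
      ((intervalIntegral.intervalIntegrable_rpow' (by linarith)).const_mul b),
    intervalIntegral.integral_const_mul, intervalIntegral.integral_const_mul,
    integral_rpow (Or.inl (by linarith)), integral_rpow (Or.inl (by linarith)),
    sub_add_cancel, Real.one_rpow, Real.one_rpow, Real.zero_rpow hx.ne',
    Real.zero_rpow (by linarith)]
  ring

theorem intervalIntegrable_beta_integrand {x y : ℝ} (hx : 0 < x) (hy : 1 ≤ y) :
    IntervalIntegrable (fun t : ℝ => t ^ (x - 1) * (1 - t) ^ (y - 1))
      MeasureTheory.volume 0 1 :=
  (intervalIntegral.intervalIntegrable_rpow' (by linarith)).mul_continuousOn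
    (ContinuousOn.rpow_const (by fun_prop) fun _ _ => Or.inr (by linarith))

/-- The tangent line of `t ↦ (1 - t) ^ p` at `t = x / (1 + x)` lies below the graph. -/
theorem tangent_le_one_sub_rpow {x p t : ℝ} (hx : 0 < x) (hp : 1 ≤ p) (ht : t ≤ 1) :
    ((1 + p * x) / (1 + x) ^ p) + (-(p * (1 + x)) / (1 + x) ^ p) * t ≤ (1 - t) ^ p := by
  have hx1 : 0 < 1 + x := by linarith
  have hs : -1 ≤ x - (1 + x) * t := by nlinarith
  have h := one_add_mul_self_le_rpow_one_add hs hp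
  have hfactor : 1 + (x - (1 + x) * t) = (1 - t) * (1 + x) := by ring
  rw [hfactor, Real.mul_rpow (by linarith) hx1.le,
    ← div_le_iff₀ (Real.rpow_pos_of_pos hx1 p)] at h
  refine le_trans (le_of_eq ?_) h
  ring

/-- For `x > 0` and `y ≥ 2`, the beta integral satisfies
`1/(x(1+x)^(y-1)) ≤ B(x,y) ≤ 1/(x(1+x))`. -/
theorem stmt_2 (x y : ℝ) (hx : 0 < x) (hy : 2 ≤ y) :
    1 / (x * (1 + x) ^ (y - 1)) ≤ (∫ t in (0 : ℝ)..1, t ^ (x - 1) * (1 - t) ^ (y - 1)) ∧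
    (∫ t in (0 : ℝ)..1, t ^ (x - 1) * (1 - t) ^ (y - 1)) ≤ 1 / (x * (1 + x)) := by
  have hp : 1 ≤ y - 1 := by linarith
  have hint := intervalIntegrable_beta_integrand hx (y := y) (by linarith)
  constructor
  · have h := intervalIntegral.integral_mono_on zero_le_one
      (intervalIntegrable_rpow_sub_one_mul_affine hx ((1 + (y - 1) * x) / (1 + x) ^ (y - 1))
        (-((y - 1) * (1 + x)) / (1 + x) ^ (y - 1))) hint fun t ht =>
      mul_le_mul_of_nonneg_left (tangent_le_one_sub_rpow hx hp ht.2) (Real.rpow_nonneg ht.1 _)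
    rw [integral_rpow_sub_one_mul_affine hx] at h
    refine le_trans (le_of_eq ?_) h
    have hpow : (1 + x) ^ (y - 1) ≠ 0 := (Real.rpow_pos_of_pos (by linarith) _).ne'
    generalize (1 + x) ^ (y - 1) = c at hpow ⊢
    field_simp
    ring
  · have h := intervalIntegral.integral_mono_on zero_le_one hint
      (intervalIntegrable_rpow_sub_one_mul_affine hx 1 (-1)) fun t ht =>
      mul_le_mul_of_nonneg_left (a := t ^ (x - 1)) (c := 1 + -1 * t) (by
        have h1 := Real.rpow_le_rpow_of_exponent_ge' (sub_nonneg.2 ht.2)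
          (sub_le_self 1 ht.1) zero_le_one hp
        rw [Real.rpow_one] at h1
        linarith) (Real.rpow_nonneg ht.1 _)
    rw [integral_rpow_sub_one_mul_affine hx] at h
    refine h.trans (le_of_eq ?_)
    field_simp
    ring
end

section
/- For every x ∈ (0,∞) and y ∈ [1,2], the beta integral B(x,y) = ∫₀¹ t^(x-1)·(1-t)^(y-1) dt satisfies 1/(x·(1+x)) ≤ B(x,y) ≤ 1/(x·(1+x)^(y-1)). -/
open intervalIntegral in
theorem intervalIntegrable_rpow_mul_affine {x : ℝ} (hx : 0 < x) (a b : ℝ) :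
    IntervalIntegrable (fun t : ℝ => t ^ (x - 1) * (a + b * (1 - t))) MeasureTheory.volume 0 1 :=
  (intervalIntegrable_rpow' (by linarith)).mul_continuousOn (by fun_prop)

open intervalIntegral in
theorem intervalIntegrable_rpow_mul_one_sub_rpow {x p : ℝ} (hx : 0 < x) (hp : 0 ≤ p) :
    IntervalIntegrable (fun t : ℝ => t ^ (x - 1) * (1 - t) ^ p) MeasureTheory.volume 0 1 :=
  (intervalIntegrable_rpow' (by linarith)).mul_continuousOn
    ((by fun_prop : Continuous fun t : ℝ => 1 - t).rpow_const fun _ => Or.inr hp).continuousOn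

open intervalIntegral in
theorem integral_rpow_mul_affine {x : ℝ} (hx : 0 < x) (a b : ℝ) :
    ∫ t in (0 : ℝ)..1, t ^ (x - 1) * (a + b * (1 - t)) = a / x + b / (x * (1 + x)) := by
  have hsplit : ∫ t in (0 : ℝ)..1, t ^ (x - 1) * (a + b * (1 - t)) =
      ∫ t in (0 : ℝ)..1, ((a + b) * t ^ (x - 1) - b * t ^ x) := by
    refine integral_congr_uIoo fun t ht => ?_
    rw [Set.uIoo_of_le zero_le_one] at ht
    have : t ^ x = t ^ (x - 1) * t := by
      rw [← Real.rpow_add_one ht.1.ne', sub_add_cancel]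
    simp only [this]
    ring
  rw [hsplit, integral_sub ((intervalIntegrable_rpow' (by linarith)).const_mul _)
    ((intervalIntegrable_rpow' (by linarith)).const_mul _), integral_const_mul,
    integral_const_mul, integral_rpow (Or.inl (by linarith)),
    integral_rpow (Or.inl (by linarith)), sub_add_cancel, Real.one_rpow, Real.one_rpow,
    Real.zero_rpow hx.ne', Real.zero_rpow (by linarith), sub_zero]
  field_simp
  ring

/-- For `x > 0` and `y ∈ [1,2]`, the beta integral satisfies
`1/(x(1+x)) ≤ B(x,y) ≤ 1/(x(1+x)^(y-1))`. -/
theorem stmt_3 (x y : ℝ) (hx : 0 < x) (hy : y ∈ Set.Icc (1 : ℝ) 2) :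
    1 / (x * (1 + x)) ≤ (∫ t in (0 : ℝ)..1, t ^ (x - 1) * (1 - t) ^ (y - 1)) ∧
    (∫ t in (0 : ℝ)..1, t ^ (x - 1) * (1 - t) ^ (y - 1)) ≤ 1 / (x * (1 + x) ^ (y - 1)) := by
  obtain ⟨hy1, hy2⟩ := hy
  have hp0 : 0 ≤ y - 1 := by linarith
  have hp1 : y - 1 ≤ 1 := by linarith
  have hint := intervalIntegrable_rpow_mul_one_sub_rpow hx hp0
  constructor
  · calc 1 / (x * (1 + x)) = ∫ t in (0 : ℝ)..1, t ^ (x - 1) * (0 + 1 * (1 - t)) := by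
          rw [integral_rpow_mul_affine hx, zero_div, zero_add]
      _ ≤ _ := by
          refine intervalIntegral.integral_mono_on zero_le_one
            (intervalIntegrable_rpow_mul_affine hx 0 1) hint fun t ht => ?_
          refine mul_le_mul_of_nonneg_left ?_ (Real.rpow_nonneg ht.1 _)
          rw [zero_add, one_mul]
          exact Real.self_le_rpow_of_le_one (by linarith [ht.2]) (by linarith [ht.1]) hp1
  · set c := (1 + x) ^ (y - 1) with hc
    have hcpos : 0 < c := Real.rpow_pos_of_pos (by linarith) _
    calc _ ≤ ∫ t in (0 : ℝ)..1,
            t ^ (x - 1) * ((1 - (y - 1)) / c + (y - 1) * (1 + x) / c * (1 - t)) := by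
          refine intervalIntegral.integral_mono_on zero_le_one hint
            (intervalIntegrable_rpow_mul_affine hx _ _) fun t ht => ?_
          refine mul_le_mul_of_nonneg_left ?_ (Real.rpow_nonneg ht.1 _)
          have h1t : 0 ≤ 1 - t := by linarith [ht.2]
          have bernoulli := rpow_one_add_le_one_add_mul_self
            (s := (1 - t) * (1 + x) - 1) (by nlinarith) hp0 hp1
          rw [add_sub_cancel, Real.mul_rpow h1t (by linarith), ← hc, ← le_div_iff₀ hcpos]
            at bernoulli
          refine bernoulli.trans_eq ?_
          ring
      _ = 1 / (x * c) := by
          rw [integral_rpow_mul_affine hx]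
          field_simp
          ring
end

section
/- Let λ, α ∈ (0,1), let I ⊆ ℝ be an interval, f : ℝ → ℝ convex on I and continuous on the segment joining a and b, where a, b ∈ I. Set r(λ,α) = λ + α - 2λα. Then f((1-r(λ,α))a + r(λ,α)b) ≤ ∫₀¹ f((1-r(λ,t))a + r(λ,t)b) dη_α(t) ≤ (1-α)·f((1-λ)a+λb) + α·f(λa+(1-λ)b) ≤ (1-α)·∫₀¹ f((1-t)a+tb) dη_λ(t) + α·∫₀¹ f((1-t)a+tb) dη_{1-λ}(t) ≤ (1-r(λ,α))f(a) + r(λ,α)f(b). -/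
/-- A convex function on a real set has a supporting line at each interior point. -/
theorem ConvexOn.exists_supporting_line {S : Set ℝ} {g : ℝ → ℝ} {m : ℝ}
    (hg : ConvexOn ℝ S g) (hm : m ∈ interior S) :
    ∃ c : ℝ, ∀ t ∈ S, g m + c * (t - m) ≤ g t := by
  refine ⟨derivWithin g (Set.Ioi m) m, fun t ht => ?_⟩
  rcases lt_trichotomy t m with h | rfl | h
  · have h1 := (hg.slope_le_leftDeriv_of_mem_interior ht hm h).trans
      (hg.leftDeriv_le_rightDeriv_of_mem_interior hm)
    rw [slope_def_field, div_le_iff₀ (by linarith)] at h1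
    linarith
  · simp
  · have h1 := hg.rightDeriv_le_slope_of_mem_interior hm ht h
    rw [slope_def_field, le_div_iff₀ (by linarith)] at h1
    linarith

theorem neg_one_lt_weight_exponent {m : ℝ} (hm : m ∈ Set.Ioo (0 : ℝ) 1) :
    -1 < (2 * m - 1) / (1 - m) := by
  rw [lt_div_iff₀ (by linarith [hm.2])]
  linarith [hm.1]

theorem intervalIntegrable_mul_weight {m : ℝ} (hm : m ∈ Set.Ioo (0 : ℝ) 1) {g : ℝ → ℝ}
    (hg : ContinuousOn g (Set.Icc 0 1)) :
    IntervalIntegrable (fun t => g t * (m / (1 - m) * t ^ ((2 * m - 1) / (1 - m))))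
      MeasureTheory.volume 0 1 := by
  refine IntervalIntegrable.continuousOn_mul ?_ (by rwa [Set.uIcc_of_le zero_le_one])
  exact (intervalIntegral.intervalIntegrable_rpow' (neg_one_lt_weight_exponent hm)).const_mul _

/-- The power weight with parameter `m` is a probability density on `[0,1]` with mean `m`. -/
theorem integral_affine_mul_weight {m : ℝ} (hm : m ∈ Set.Ioo (0 : ℝ) 1) (A B : ℝ) :
    ∫ t in (0 : ℝ)..1, (A + B * t) * (m / (1 - m) * t ^ ((2 * m - 1) / (1 - m))) =
      A + B * m := by
  have hp := neg_one_lt_weight_exponent hm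
  have h1m : (1 - m) ≠ 0 := by linarith [hm.2]
  have hm0 : m ≠ 0 := hm.1.ne'
  set p := (2 * m - 1) / (1 - m) with hpdef
  have hp1 : p + 1 = m / (1 - m) := by rw [hpdef]; field_simp; ring
  have hp2 : p + 1 + 1 = 1 / (1 - m) := by rw [hp1]; field_simp; ring
  have hcongr : ∫ t in (0 : ℝ)..1, (A + B * t) * (m / (1 - m) * t ^ p) =
      ∫ t in (0 : ℝ)..1, (A * (m / (1 - m)) * t ^ p + B * (m / (1 - m)) * t ^ (p + 1)) := by
    refine intervalIntegral.integral_congr_ae (Filter.Eventually.of_forall fun t ht => ?_)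
    rw [Set.uIoc_of_le zero_le_one] at ht
    simp only [Real.rpow_add_one ht.1.ne']
    ring
  rw [hcongr, intervalIntegral.integral_add
    ((intervalIntegral.intervalIntegrable_rpow' hp).const_mul _)
    ((intervalIntegral.intervalIntegrable_rpow' (by linarith)).const_mul _),
    intervalIntegral.integral_const_mul, intervalIntegral.integral_const_mul,
    integral_rpow (Or.inl hp), integral_rpow (Or.inl (by linarith)),
    Real.zero_rpow (by linarith), Real.zero_rpow (by linarith), Real.one_rpow, Real.one_rpow,
    hp2, hp1]
  field_simp
  ring

/-- One-parameter weighted Hermite–Hadamard inequality on `[0,1]`. -/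
theorem ConvexOn.weighted_hermite_hadamard {m : ℝ} (hm : m ∈ Set.Ioo (0 : ℝ) 1) {g : ℝ → ℝ}
    (hg : ConvexOn ℝ (Set.Icc 0 1) g) (hc : ContinuousOn g (Set.Icc 0 1)) :
    g m ≤ (∫ t in (0 : ℝ)..1, g t * (m / (1 - m) * t ^ ((2 * m - 1) / (1 - m)))) ∧
    (∫ t in (0 : ℝ)..1, g t * (m / (1 - m) * t ^ ((2 * m - 1) / (1 - m)))) ≤
      (1 - m) * g 0 + m * g 1 := by
  have hw : ∀ t ∈ Set.Icc (0 : ℝ) 1, 0 ≤ m / (1 - m) * t ^ ((2 * m - 1) / (1 - m)) :=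
    fun t ht => mul_nonneg (div_nonneg hm.1.le (by linarith [hm.2])) (Real.rpow_nonneg ht.1 _)
  have haff (A B : ℝ) := intervalIntegrable_mul_weight hm (g := fun t => A + B * t)
    (by fun_prop)
  constructor
  · obtain ⟨c, hcm⟩ := hg.exists_supporting_line (m := m) (by rwa [interior_Icc])
    have h := intervalIntegral.integral_mono_on zero_le_one (haff (g m - c * m) c)
      (intervalIntegrable_mul_weight hm hc) fun t ht =>
        mul_le_mul_of_nonneg_right (by linarith [hcm t ht]) (hw t ht)
    rw [integral_affine_mul_weight hm] at h
    linarith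
  · have h := intervalIntegral.integral_mono_on zero_le_one
      (intervalIntegrable_mul_weight hm hc) (haff (g 0) (g 1 - g 0)) fun t ht => by
        refine mul_le_mul_of_nonneg_right ?_ (hw t ht)
        have := hg.2 (Set.left_mem_Icc.2 zero_le_one) (Set.right_mem_Icc.2 zero_le_one)
          (sub_nonneg.2 ht.2) ht.1 (by ring)
        simp only [smul_eq_mul, mul_zero, mul_one, zero_add] at this
        linarith
    rw [integral_affine_mul_weight hm] at h
    linarith

theorem convexOn_Icc_comp_segment {I : Set ℝ} {f : ℝ → ℝ} (hf : ConvexOn ℝ I f) {x y : ℝ}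
    (hx : x ∈ I) (hy : y ∈ I) :
    ConvexOn ℝ (Set.Icc 0 1) fun t : ℝ => f ((1 - t) * x + t * y) := by
  refine ⟨convex_Icc 0 1, fun s hs t ht p q hp hq hpq => ?_⟩
  have hmem : ∀ u ∈ Set.Icc (0 : ℝ) 1, (1 - u) * x + u * y ∈ I := fun u hu =>
    hf.1 hx hy (sub_nonneg.2 hu.2) hu.1 (by ring)
  have h := hf.2 (hmem s hs) (hmem t ht) hp hq hpq
  convert h using 2
  obtain rfl : q = 1 - p := by linarith
  simp only [smul_eq_mul]
  ring

theorem continuousOn_Icc_comp_segment {f : ℝ → ℝ} {x y : ℝ}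
    (hf : ContinuousOn f (segment ℝ x y)) :
    ContinuousOn (fun t : ℝ => f ((1 - t) * x + t * y)) (Set.Icc 0 1) :=
  hf.comp (by fun_prop) fun t ht => ⟨1 - t, t, sub_nonneg.2 ht.2, ht.1, by ring, rfl⟩


/-- Scalar two-parameter weighted Hermite–Hadamard inequality, with
`r(λ,α) = λ + α - 2λα`, `η_μ` the measure on `[0,1]` with density
`t ↦ (μ/(1-μ)) t^((2μ-1)/(1-μ))`. -/
theorem stmt_5 (l al : ℝ) (hl : l ∈ Set.Ioo (0 : ℝ) 1) (hal : al ∈ Set.Ioo (0 : ℝ) 1)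
    (I : Set ℝ) (hI : Convex ℝ I) (f : ℝ → ℝ) (hf : ConvexOn ℝ I f)
    (a b : ℝ) (ha : a ∈ I) (hb : b ∈ I) (hcont : ContinuousOn f (segment ℝ a b))
    (r : ℝ → ℝ → ℝ) (hr : ∀ ν γ : ℝ, r ν γ = ν + γ - 2 * ν * γ) :
    f ((1 - r l al) * a + r l al * b) ≤
      (∫ t in (0 : ℝ)..1, f ((1 - r l t) * a + r l t * b) *
        (al / (1 - al) * t ^ ((2 * al - 1) / (1 - al)))) ∧
    (∫ t in (0 : ℝ)..1, f ((1 - r l t) * a + r l t * b) *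
        (al / (1 - al) * t ^ ((2 * al - 1) / (1 - al)))) ≤
      (1 - al) * f ((1 - l) * a + l * b) + al * f (l * a + (1 - l) * b) ∧
    (1 - al) * f ((1 - l) * a + l * b) + al * f (l * a + (1 - l) * b) ≤
      (1 - al) * (∫ t in (0 : ℝ)..1, f ((1 - t) * a + t * b) *
          (l / (1 - l) * t ^ ((2 * l - 1) / (1 - l)))) +
        al * (∫ t in (0 : ℝ)..1, f ((1 - t) * a + t * b) *
          ((1 - l) / l * t ^ ((2 * (1 - l) - 1) / (1 - (1 - l))))) ∧
    (1 - al) * (∫ t in (0 : ℝ)..1, f ((1 - t) * a + t * b) *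
          (l / (1 - l) * t ^ ((2 * l - 1) / (1 - l)))) +
        al * (∫ t in (0 : ℝ)..1, f ((1 - t) * a + t * b) *
          ((1 - l) / l * t ^ ((2 * (1 - l) - 1) / (1 - (1 - l))))) ≤
      (1 - r l al) * f a + r l al * f b := by
  have h1l : 1 - l ∈ Set.Ioo (0 : ℝ) 1 := ⟨by linarith [hl.2], by linarith [hl.1]⟩
  have hx : (1 - l) * a + l * b ∈ segment ℝ a b :=
    ⟨1 - l, l, h1l.1.le, hl.1.le, by ring, rfl⟩
  have hy : l * a + (1 - l) * b ∈ segment ℝ a b :=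
    ⟨l, 1 - l, hl.1.le, h1l.1.le, by ring, rfl⟩
  have hsub := hI.segment_subset ha hb
  have hmid := (convexOn_Icc_comp_segment hf (hsub hx) (hsub hy)).weighted_hermite_hadamard hal
    (continuousOn_Icc_comp_segment
      (hcont.mono ((convex_segment a b).segment_subset hx hy)))
  have hpt : ∀ t : ℝ, (1 - t) * ((1 - l) * a + l * b) + t * (l * a + (1 - l) * b) =
      (1 - r l t) * a + r l t * b := fun t => by rw [hr]; ring
  simp only [hpt] at hmid
  have hab := convexOn_Icc_comp_segment hf ha hb
  have hcab := continuousOn_Icc_comp_segment hcont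
  obtain ⟨hlo, hhi⟩ := hab.weighted_hermite_hadamard hl hcab
  obtain ⟨hlo', hhi'⟩ := hab.weighted_hermite_hadamard h1l hcab
  have hdiv : (1 - l) / (1 - (1 - l)) = (1 - l) / l := by rw [sub_sub_cancel]
  rw [hdiv] at hlo' hhi'
  simp only [sub_zero, one_mul, zero_mul, add_zero, sub_self, zero_add] at hhi hhi'
  have hal' : 0 ≤ 1 - al := by linarith [hal.2]
  refine ⟨hmid.1, hmid.2.trans_eq ?_, ?_, ?_⟩
  · rw [hr, hr]
    ring_nf
  · exact add_le_add (mul_le_mul_of_nonneg_left hlo hal')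
      (mul_le_mul_of_nonneg_left (by simpa only [sub_sub_cancel] using hlo') hal.1.le)
  · refine (add_le_add (mul_le_mul_of_nonneg_left hhi hal')
      (mul_le_mul_of_nonneg_left hhi' hal.1.le)).trans_eq ?_
    rw [hr]
    ring
end

section
/- Let α ∈ (0,1), let I ⊆ ℝ be an interval, f : ℝ → ℝ convex on I and continuous on the segment joining a and b, where a, b ∈ I. Define M_{λ,α} = (1-α)·∫₀¹ f((1-t)a+tb) dη_λ(t) + α·∫₀¹ f((1-t)a+tb) dη_{1-λ}(t) for λ ∈ (0,1). Then M_{λ,α} tends to (1-α)f(a) + αf(b) as λ → 0⁺ (within (0,1)), and M_{λ,α} tends to αf(a) + (1-α)f(b) as λ → 1⁻ (within (0,1)). -/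
open MeasureTheory Set Filter Topology

/-- The substitution `s = t ^ p` on `[0, 1]`. -/
theorem integral_mul_rpow_sub_one_eq (g : ℝ → ℝ) {p : ℝ} (hp : 0 < p) :
    ∫ t in (0 : ℝ)..1, g t * (p * t ^ (p - 1)) = ∫ s in (0 : ℝ)..1, g (s ^ p⁻¹) := by
  have h := integral_comp_rpow_Ioi ((Ioc (0 : ℝ) 1).indicator fun s => g (s ^ p⁻¹)) hp.ne'
  have hsub : Ioi (0 : ℝ) ∩ Ioc 0 1 = Ioc 0 1 := inter_eq_right.2 fun x hx => hx.1
  rw [setIntegral_indicator measurableSet_Ioc, hsub] at h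
  rw [intervalIntegral.integral_of_le zero_le_one, intervalIntegral.integral_of_le zero_le_one,
    ← h, ← hsub, ← setIntegral_indicator measurableSet_Ioc]
  refine setIntegral_congr_fun measurableSet_Ioi fun x (hx : 0 < x) => ?_
  by_cases hx1 : x ≤ 1
  · have hmem : x ^ p ∈ Ioc (0 : ℝ) 1 :=
      ⟨Real.rpow_pos_of_pos hx p, Real.rpow_le_one hx.le hx1 hp.le⟩
    simp only [hsub, indicator_of_mem hmem,
      indicator_of_mem (show x ∈ Ioc (0 : ℝ) 1 from ⟨hx, hx1⟩),
      Real.rpow_rpow_inv hx.le hp.ne', abs_of_pos hp, smul_eq_mul]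
    ring
  · have hmem : x ^ p ∉ Ioc (0 : ℝ) 1 := fun h' =>
      (Real.one_lt_rpow (not_le.1 hx1) hp).not_ge h'.2
    simp only [hsub, indicator_of_notMem hmem,
      indicator_of_notMem (show x ∉ Ioc (0 : ℝ) 1 from fun h' => hx1 h'.2), smul_zero]

/-- If `s ^ (p i)⁻¹` converges to `c` for all `s ∈ (0, 1)`, then the probability measures with
density `p i * t ^ (p i - 1)` on `[0, 1]` converge weakly to the Dirac mass at `c`. -/
theorem tendsto_integral_mul_rpow_sub_one {ι : Type*} {F : Filter ι} [F.IsCountablyGenerated]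
    {g : ℝ → ℝ} (hg : ContinuousOn g (Icc 0 1)) {p : ι → ℝ} (hp : ∀ᶠ i in F, 0 < p i)
    {c : ℝ} (hc : c ∈ Icc (0 : ℝ) 1)
    (hlim : ∀ s ∈ Ioo (0 : ℝ) 1, Tendsto (fun i => s ^ (p i)⁻¹) F (𝓝 c)) :
    Tendsto (fun i => ∫ t in (0 : ℝ)..1, g t * (p i * t ^ (p i - 1))) F (𝓝 (g c)) := by
  have hmem : ∀ {q s : ℝ}, 0 < q → s ∈ Icc (0 : ℝ) 1 → s ^ q⁻¹ ∈ Icc (0 : ℝ) 1 :=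
    fun hq hs => ⟨Real.rpow_nonneg hs.1 _, Real.rpow_le_one hs.1 hs.2 (inv_pos.2 hq).le⟩
  obtain ⟨C, hC⟩ := isCompact_Icc.exists_bound_of_continuousOn hg
  have key : Tendsto (fun i => ∫ s in (0 : ℝ)..1, g (s ^ (p i)⁻¹)) F
      (𝓝 (∫ _ in (0 : ℝ)..1, g c)) := by
    refine intervalIntegral.tendsto_integral_filter_of_dominated_convergence (fun _ => C) ?_ ?_
      intervalIntegrable_const ?_
    · filter_upwards [hp] with i hi
      rw [uIoc_of_le zero_le_one]
      refine ContinuousOn.aestronglyMeasurable ?_ measurableSet_Ioc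
      exact hg.comp (Real.continuous_rpow_const (inv_pos.2 hi).le).continuousOn
        fun s hs => hmem hi (Ioc_subset_Icc_self hs)
    · filter_upwards [hp] with i hi
      refine Eventually.of_forall fun s hs => ?_
      rw [uIoc_of_le zero_le_one] at hs
      exact hC _ (hmem hi (Ioc_subset_Icc_self hs))
    · filter_upwards [Measure.ae_ne volume (1 : ℝ)] with s hs1 hs
      rw [uIoc_of_le zero_le_one] at hs
      refine (hg c hc).tendsto.comp (tendsto_nhdsWithin_iff.2
        ⟨hlim s ⟨hs.1, lt_of_le_of_ne hs.2 hs1⟩, ?_⟩)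
      filter_upwards [hp] with i hi using hmem hi (Ioc_subset_Icc_self hs)
  rw [intervalIntegral.integral_const, sub_zero, one_smul] at key
  refine key.congr' ?_
  filter_upwards [hp] with i hi using (integral_mul_rpow_sub_one_eq g hi).symm

theorem tendsto_integral_mul_rpow_sub_one_of_tendsto_zero {ι : Type*} {F : Filter ι}
    [F.IsCountablyGenerated] {g : ℝ → ℝ} (hg : ContinuousOn g (Icc 0 1)) {p : ι → ℝ}
    (hp : ∀ᶠ i in F, 0 < p i) (hp0 : Tendsto p F (𝓝 0)) :
    Tendsto (fun i => ∫ t in (0 : ℝ)..1, g t * (p i * t ^ (p i - 1))) F (𝓝 (g 0)) := by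
  refine tendsto_integral_mul_rpow_sub_one hg hp ⟨le_rfl, zero_le_one⟩ fun s hs => ?_
  exact (tendsto_rpow_atTop_of_base_lt_one s (by linarith [hs.1]) hs.2).comp
    (tendsto_inv_nhdsGT_zero.comp (tendsto_nhdsWithin_iff.2 ⟨hp0, hp⟩))

theorem tendsto_integral_mul_rpow_sub_one_of_tendsto_inv_zero {ι : Type*} {F : Filter ι}
    [F.IsCountablyGenerated] {g : ℝ → ℝ} (hg : ContinuousOn g (Icc 0 1)) {p : ι → ℝ}
    (hp : ∀ᶠ i in F, 0 < p i) (hp0 : Tendsto (fun i => (p i)⁻¹) F (𝓝 0)) :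
    Tendsto (fun i => ∫ t in (0 : ℝ)..1, g t * (p i * t ^ (p i - 1))) F (𝓝 (g 1)) := by
  refine tendsto_integral_mul_rpow_sub_one hg hp ⟨zero_le_one, le_rfl⟩ fun s hs => ?_
  simpa [Function.comp_def] using (Real.continuousAt_const_rpow hs.1.ne').tendsto.comp hp0

theorem tendsto_div_one_sub_nhdsWithin_zero :
    Tendsto (fun l : ℝ => l / (1 - l)) (𝓝[Ioo 0 1] 0) (𝓝 0) := by
  have h : ContinuousAt (fun l : ℝ => l / (1 - l)) 0 :=
    continuousAt_id.div (continuousAt_const.sub continuousAt_id) (by simp)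
  simpa using h.tendsto.mono_left nhdsWithin_le_nhds

theorem tendsto_one_sub_div_nhdsWithin_one :
    Tendsto (fun l : ℝ => (1 - l) / l) (𝓝[Ioo 0 1] 1) (𝓝 0) := by
  have h : ContinuousAt (fun l : ℝ => (1 - l) / l) 1 :=
    (continuousAt_const.sub continuousAt_id).div continuousAt_id one_ne_zero
  simpa using h.tendsto.mono_left nhdsWithin_le_nhds


/-- Boundary behaviour of `λ ↦ M_{λ,α}(f;a,b)`:
as `λ → 0⁺` it tends to `(1-α)f(a) + αf(b)` and as `λ → 1⁻` to `αf(a) + (1-α)f(b)`. -/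
theorem stmt_6 (al : ℝ) (hal : al ∈ Set.Ioo (0 : ℝ) 1)
    (I : Set ℝ) (hI : Convex ℝ I) (f : ℝ → ℝ) (hf : ConvexOn ℝ I f)
    (a b : ℝ) (ha : a ∈ I) (hb : b ∈ I) (hcont : ContinuousOn f (segment ℝ a b)) :
    Filter.Tendsto (fun l : ℝ =>
        (1 - al) * (∫ t in (0 : ℝ)..1, f ((1 - t) * a + t * b) *
            (l / (1 - l) * t ^ ((2 * l - 1) / (1 - l)))) +
          al * (∫ t in (0 : ℝ)..1, f ((1 - t) * a + t * b) *
            ((1 - l) / l * t ^ ((2 * (1 - l) - 1) / (1 - (1 - l))))))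
      (nhdsWithin 0 (Set.Ioo 0 1)) (nhds ((1 - al) * f a + al * f b)) ∧
    Filter.Tendsto (fun l : ℝ =>
        (1 - al) * (∫ t in (0 : ℝ)..1, f ((1 - t) * a + t * b) *
            (l / (1 - l) * t ^ ((2 * l - 1) / (1 - l)))) +
          al * (∫ t in (0 : ℝ)..1, f ((1 - t) * a + t * b) *
            ((1 - l) / l * t ^ ((2 * (1 - l) - 1) / (1 - (1 - l))))))
      (nhdsWithin 1 (Set.Ioo 0 1)) (nhds (al * f a + (1 - al) * f b)) := by
  have hg : ContinuousOn (fun t : ℝ => f ((1 - t) * a + t * b)) (Icc 0 1) :=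
    hcont.comp (by fun_prop) fun t ht =>
      ⟨1 - t, t, by linarith [ht.2], ht.1, by ring, by simp⟩
  have hmem : ∀ x : ℝ, ∀ᶠ l in 𝓝[Ioo 0 1] x, l ∈ Ioo (0 : ℝ) 1 := fun x => self_mem_nhdsWithin
  have hpos : ∀ x : ℝ, ∀ᶠ l in 𝓝[Ioo 0 1] x, 0 < l / (1 - l) := fun x =>
    (hmem x).mono fun l hl => div_pos hl.1 (sub_pos.2 hl.2)
  have hpos' : ∀ x : ℝ, ∀ᶠ l in 𝓝[Ioo 0 1] x, 0 < (1 - l) / l := fun x =>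
    (hmem x).mono fun l hl => div_pos (sub_pos.2 hl.2) hl.1
  have hexp : ∀ l ∈ Ioo (0 : ℝ) 1, l / (1 - l) - 1 = (2 * l - 1) / (1 - l) ∧
      (1 - l) / l - 1 = (2 * (1 - l) - 1) / (1 - (1 - l)) := fun l hl => by
    have h0 : l ≠ 0 := hl.1.ne'
    have h1 : 1 - l ≠ 0 := (sub_pos.2 hl.2).ne'
    rw [sub_sub_cancel]
    constructor
    · field_simp
      ring
    · field_simp
      ring
  constructor
  · have h1 := tendsto_integral_mul_rpow_sub_one_of_tendsto_zero hg (hpos 0)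
      tendsto_div_one_sub_nhdsWithin_zero
    have h2 := tendsto_integral_mul_rpow_sub_one_of_tendsto_inv_zero hg (hpos' 0)
      (by simpa only [inv_div] using tendsto_div_one_sub_nhdsWithin_zero)
    have h := (h1.const_mul (1 - al)).add (h2.const_mul al)
    simp only [sub_zero, sub_self, one_mul, zero_mul, add_zero, zero_add] at h
    refine h.congr' ((hmem 0).mono fun l hl => ?_)
    simp only [(hexp l hl).1, (hexp l hl).2]
  · have h1 := tendsto_integral_mul_rpow_sub_one_of_tendsto_inv_zero hg (hpos 1)
      (by simpa only [inv_div] using tendsto_one_sub_div_nhdsWithin_one)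
    have h2 := tendsto_integral_mul_rpow_sub_one_of_tendsto_zero hg (hpos' 1)
      tendsto_one_sub_div_nhdsWithin_one
    have h := (h1.const_mul (1 - al)).add (h2.const_mul al)
    simp only [sub_zero, sub_self, one_mul, zero_mul, add_zero, zero_add] at h
    rw [add_comm (al * f a)]
    refine h.congr' ((hmem 1).mono fun l hl => ?_)
    simp only [(hexp l hl).1, (hexp l hl).2]
end

section
/- Let λ ∈ (0,1), let I ⊆ ℝ be an interval, f : ℝ → ℝ convex on I and continuous on the segment joining a and b, where a, b ∈ I. Write a∇_t b = (1-t)a + tb and c = a∇_λ b. Then f(c) ≤ ∫₀¹ f((c + a∇_x b)/2) dη_λ(x) ≤ ∫₀¹ (∫₀¹ f((1-t)c + t·(a∇_x b)) dσ_{λ,1/2}(t)) dη_λ(x) ≤ (1/2)·f(c) + (1/2)·∫₀¹ f(a∇_x b) dη_λ(x) ≤ ∫₀¹ f(a∇_x b) dη_λ(x). -/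
open MeasureTheory Set

/-- The probability measure on `[0, 1]` with density `t ↦ l / (1 - l) * t ^ ((2l - 1) / (1 - l))`. -/
noncomputable def powerMeasure (l : ℝ) : Measure ℝ :=
  (volume.restrict (Ioc (0 : ℝ) 1)).withDensity
    fun x ↦ ENNReal.ofReal (l / (1 - l) * x ^ ((2 * l - 1) / (1 - l)))

lemma ae_mem_Ioc_powerMeasure (l : ℝ) : ∀ᵐ x ∂powerMeasure l, x ∈ Ioc (0 : ℝ) 1 :=
  (withDensity_absolutelyContinuous _ _).ae_le (ae_restrict_mem measurableSet_Ioc)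

lemma integral_powerMeasure {l : ℝ} (hl : l ∈ Ioo (0 : ℝ) 1) (F : ℝ → ℝ) :
    ∫ x, F x ∂powerMeasure l =
      ∫ x in (0 : ℝ)..1, F x * (l / (1 - l) * x ^ ((2 * l - 1) / (1 - l))) := by
  have h1 : 0 < 1 - l := sub_pos.2 hl.2
  rw [powerMeasure, integral_withDensity_eq_integral_toReal_smul (by fun_prop)
    (Filter.Eventually.of_forall fun _ ↦ ENNReal.ofReal_lt_top),
    intervalIntegral.integral_of_le zero_le_one]
  refine setIntegral_congr_fun measurableSet_Ioc fun x hx ↦ ?_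
  have hw : 0 ≤ l / (1 - l) * x ^ ((2 * l - 1) / (1 - l)) :=
    mul_nonneg (div_pos hl.1 h1).le (Real.rpow_nonneg hx.1.le _)
  simp only [ENNReal.toReal_ofReal hw, smul_eq_mul]
  exact mul_comm _ _

lemma intervalIntegral_eq_integral_powerMeasure {l : ℝ} (hl : l ∈ Ioo (0 : ℝ) 1) {F H : ℝ → ℝ}
    (hFH : ∀ x ∈ Icc (0 : ℝ) 1, F x = H x) :
    ∫ x in (0 : ℝ)..1, F x * (l / (1 - l) * x ^ ((2 * l - 1) / (1 - l))) =
      ∫ x, H x ∂powerMeasure l := by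
  rw [← integral_powerMeasure hl]
  refine integral_congr_ae ?_
  filter_upwards [ae_mem_Ioc_powerMeasure l] with x hx using hFH x (Ioc_subset_Icc_self hx)

lemma neg_one_lt_powerMeasure_exponent {l : ℝ} (hl : l ∈ Ioo (0 : ℝ) 1) :
    -1 < (2 * l - 1) / (1 - l) := by
  rw [lt_div_iff₀ (sub_pos.2 hl.2)]
  linarith [hl.1]

lemma isProbabilityMeasure_powerMeasure {l : ℝ} (hl : l ∈ Ioo (0 : ℝ) 1) :
    IsProbabilityMeasure (powerMeasure l) := by
  have h1 : 0 < 1 - l := sub_pos.2 hl.2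
  have hp := neg_one_lt_powerMeasure_exponent hl
  have h : ∫ _, (1 : ℝ) ∂powerMeasure l = 1 := by
    rw [integral_powerMeasure hl]
    simp only [one_mul]
    rw [intervalIntegral.integral_const_mul, integral_rpow (Or.inl hp),
      show (2 * l - 1) / (1 - l) + 1 = l / (1 - l) by field_simp; ring, Real.one_rpow,
      Real.zero_rpow (div_pos hl.1 h1).ne']
    have := hl.1
    field_simp
    ring
  refine isProbabilityMeasure_iff_real.2 ?_
  simpa using h

lemma integral_id_powerMeasure {l : ℝ} (hl : l ∈ Ioo (0 : ℝ) 1) :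
    ∫ x, x ∂powerMeasure l = l := by
  have h1 : 0 < 1 - l := sub_pos.2 hl.2
  have hp := neg_one_lt_powerMeasure_exponent hl
  rw [integral_powerMeasure hl, intervalIntegral.integral_congr_ae
    (g := fun x ↦ l / (1 - l) * x ^ ((2 * l - 1) / (1 - l) + 1))]
  · rw [intervalIntegral.integral_const_mul, integral_rpow (Or.inl (by linarith)),
      show (2 * l - 1) / (1 - l) + 1 + 1 = 1 / (1 - l) by field_simp; ring, Real.one_rpow,
      Real.zero_rpow (one_div_pos.2 h1).ne']
    field_simp
    ring
  · refine Filter.Eventually.of_forall fun x hx ↦ ?_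
    rw [uIoc_of_le zero_le_one] at hx
    rw [Real.rpow_add_one hx.1.ne']
    ring

section Convex

variable {l : ℝ} {h : ℝ → ℝ} {C : ℝ}

lemma integrable_powerMeasure (hl : l ∈ Ioo (0 : ℝ) 1) (hm : StronglyMeasurable h)
    (hC : ∀ x, |h x| ≤ C) : Integrable h (powerMeasure l) :=
  have := isProbabilityMeasure_powerMeasure hl
  .of_bound hm.aestronglyMeasurable C (Filter.Eventually.of_forall hC)

lemma integrable_id_powerMeasure (hl : l ∈ Ioo (0 : ℝ) 1) :
    Integrable (fun x ↦ x) (powerMeasure l) := by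
  have := isProbabilityMeasure_powerMeasure hl
  refine .of_bound (by fun_prop) 1 ?_
  filter_upwards [ae_mem_Ioc_powerMeasure l] with x hx
  rw [Real.norm_of_nonneg hx.1.le]
  exact hx.2

lemma ConvexOn.le_integral_powerMeasure (hl : l ∈ Ioo (0 : ℝ) 1)
    (hh : ConvexOn ℝ (Icc 0 1) h) (hc : Continuous h) (hC : ∀ x, |h x| ≤ C) :
    h l ≤ ∫ x, h x ∂powerMeasure l := by
  have := isProbabilityMeasure_powerMeasure hl
  have key := hh.map_integral_le (μ := powerMeasure l) (f := fun x ↦ x) hc.continuousOn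
    isClosed_Icc ((ae_mem_Ioc_powerMeasure l).mono fun x hx ↦ Ioc_subset_Icc_self hx)
    (integrable_id_powerMeasure hl) (integrable_powerMeasure hl hc.stronglyMeasurable hC)
  rwa [integral_id_powerMeasure hl] at key

lemma ConvexOn.integral_powerMeasure_le (hl : l ∈ Ioo (0 : ℝ) 1)
    (hh : ConvexOn ℝ (Icc 0 1) h) (hc : Continuous h) (hC : ∀ x, |h x| ≤ C) :
    ∫ x, h x ∂powerMeasure l ≤ (1 - l) * h 0 + l * h 1 := by
  have := isProbabilityMeasure_powerMeasure hl
  have hi := (integrable_id_powerMeasure hl).mul_const (h 1 - h 0)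
  calc ∫ x, h x ∂powerMeasure l
      ≤ ∫ x, (h 0 + x * (h 1 - h 0)) ∂powerMeasure l := by
        refine integral_mono_ae (integrable_powerMeasure hl hc.stronglyMeasurable hC)
          ((integrable_const _).add hi) ?_
        filter_upwards [ae_mem_Ioc_powerMeasure l] with x hx
        have := hh.2 (left_mem_Icc.2 zero_le_one) (right_mem_Icc.2 zero_le_one)
          (sub_nonneg.2 hx.2) hx.1.le (sub_add_cancel 1 x)
        simp only [smul_eq_mul, mul_zero, mul_one, zero_add] at this
        linarith
    _ = (1 - l) * h 0 + l * h 1 := by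
        rw [integral_add (integrable_const _) hi, integral_mul_const,
          integral_id_powerMeasure hl]
        simp
        ring

lemma ConvexOn.comp_lineMap_Icc {s : Set ℝ} {g : ℝ → ℝ} (hg : ConvexOn ℝ s g) {p q : ℝ}
    (hp : p ∈ s) (hq : q ∈ s) : ConvexOn ℝ (Icc 0 1) fun t ↦ g ((1 - t) * p + t * q) := by
  refine ⟨convex_Icc 0 1, fun x hx y hy u v hu hv huv ↦ ?_⟩
  have hmem : ∀ t ∈ Icc (0 : ℝ) 1, (1 - t) * p + t * q ∈ s := fun t ht ↦
    hg.1 hp hq (sub_nonneg.2 ht.2) ht.1 (sub_add_cancel 1 t)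
  convert hg.2 (hmem x hx) (hmem y hy) hu hv huv using 2
  simp only [smul_eq_mul]
  linear_combination (-p) * huv

/-- The refinement of the left weighted Hermite–Hadamard inequality on `[0, 1]`. -/
lemma ConvexOn.hermiteHadamard_chain_powerMeasure (hl : l ∈ Ioo (0 : ℝ) 1)
    (hh : ConvexOn ℝ (Icc 0 1) h) (hc : Continuous h) (hC : ∀ x, |h x| ≤ C) :
    h l ≤ ∫ x, h ((l + x) / 2) ∂powerMeasure l ∧
    ∫ x, h ((l + x) / 2) ∂powerMeasure l ≤
      ∫ x, ((1 / 2) * ∫ t, h ((1 - t) * l + t * x) ∂powerMeasure l) +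
        (1 / 2) * ∫ t, h ((1 - t) * l + t * x) ∂powerMeasure (1 - l) ∂powerMeasure l ∧
    ∫ x, ((1 / 2) * ∫ t, h ((1 - t) * l + t * x) ∂powerMeasure l) +
        (1 / 2) * ∫ t, h ((1 - t) * l + t * x) ∂powerMeasure (1 - l) ∂powerMeasure l ≤
      (1 / 2) * h l + (1 / 2) * ∫ x, h x ∂powerMeasure l ∧
    (1 / 2) * h l + (1 / 2) * ∫ x, h x ∂powerMeasure l ≤ ∫ x, h x ∂powerMeasure l := by
  have hl' : 1 - l ∈ Ioo (0 : ℝ) 1 := ⟨sub_pos.2 hl.2, sub_lt_self 1 hl.1⟩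
  have hlI : l ∈ Icc (0 : ℝ) 1 := Ioo_subset_Icc_self hl
  have := isProbabilityMeasure_powerMeasure hl
  have := isProbabilityMeasure_powerMeasure hl'
  have hline (x : ℝ) (hx : x ∈ Icc (0 : ℝ) 1) :
      ConvexOn ℝ (Icc 0 1) fun t ↦ h ((1 - t) * l + t * x) := hh.comp_lineMap_Icc hlI hx
  have hlinec (x : ℝ) : Continuous fun t ↦ h ((1 - t) * l + t * x) := by fun_prop
  have hmid : ConvexOn ℝ (Icc 0 1) fun x ↦ h ((l + x) / 2) := by
    convert hh.comp_lineMap_Icc (p := l / 2) (q := (l + 1) / 2)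
      ⟨by linarith [hl.1], by linarith [hl.2]⟩ ⟨by linarith [hl.1], by linarith [hl.2]⟩ using 3
    ring
  have hmidI : Integrable (fun x ↦ h ((l + x) / 2)) (powerMeasure l) :=
    integrable_powerMeasure hl (by fun_prop : Continuous _).stronglyMeasurable fun x ↦ hC _
  have hI : Integrable h (powerMeasure l) := integrable_powerMeasure hl hc.stronglyMeasurable hC
  have hparam (μ : Measure ℝ) [IsProbabilityMeasure μ] :
      Integrable (fun x ↦ ∫ t, h ((1 - t) * l + t * x) ∂μ) (powerMeasure l) := by
    refine integrable_powerMeasure hl (C := C) ?_ fun x ↦ ?_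
    · refine StronglyMeasurable.integral_prod_right (f := fun x t ↦ h ((1 - t) * l + t * x)) ?_
      exact (by fun_prop : Continuous fun z : ℝ × ℝ ↦
        h ((1 - z.2) * l + z.2 * z.1)).stronglyMeasurable
    · simpa using norm_integral_le_of_norm_le_const (μ := μ) (C := C)
        (f := fun t ↦ h ((1 - t) * l + t * x)) (Filter.Eventually.of_forall fun t ↦ hC _)
  have hdouble := ((hparam (powerMeasure l)).const_mul (1 / 2)).add
    ((hparam (powerMeasure (1 - l))).const_mul (1 / 2))
  have hjensen := hh.le_integral_powerMeasure hl hc hC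
  refine ⟨?_, integral_mono_ae hmidI hdouble ?_, ?_, by linarith⟩
  · simpa using hmid.le_integral_powerMeasure hl (by fun_prop) fun x ↦ hC _
  · filter_upwards [ae_mem_Ioc_powerMeasure l] with x hx
    have hx := hline x (Ioc_subset_Icc_self hx)
    have h1 := hx.le_integral_powerMeasure hl (hlinec x) fun t ↦ hC _
    have h2 := hx.le_integral_powerMeasure hl' (hlinec x) fun t ↦ hC _
    have h3 := hx.2 hlI (Ioo_subset_Icc_self hl') (one_half_pos (α := ℝ)).le
      one_half_pos.le (add_halves 1)
    simp only [smul_eq_mul] at h3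
    rw [show (1 - (1 / 2 * l + 1 / 2 * (1 - l))) * l + (1 / 2 * l + 1 / 2 * (1 - l)) * x =
      (l + x) / 2 by ring] at h3
    change _ ≤ _ + _
    linarith
  · calc _ ≤ ∫ x, ((1 / 2) * h l + (1 / 2) * h x) ∂powerMeasure l := by
          refine integral_mono_ae hdouble ((integrable_const _).add (hI.const_mul _)) ?_
          filter_upwards [ae_mem_Ioc_powerMeasure l] with x hx
          have hx := hline x (Ioc_subset_Icc_self hx)
          have h1 := hx.integral_powerMeasure_le hl (hlinec x) fun t ↦ hC _
          have h2 := hx.integral_powerMeasure_le hl' (hlinec x) fun t ↦ hC _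
          simp only [sub_zero, one_mul, zero_mul, add_zero, sub_self, zero_add] at h1 h2
          change _ + _ ≤ _ + _
          linarith
      _ = _ := by
          rw [integral_add (integrable_const _) (hI.const_mul _),
            integral_const_mul (1 / 2) h]
          simp

end Convex


/-- Scalar case of Theorem 2.7: the chain of inequalities refining the left weighted
Hermite–Hadamard inequality, with `c = a∇_λ b` and `σ_{λ,1/2} = (η_λ + η_{1-λ})/2`. -/
theorem stmt_7 (l : ℝ) (hl : l ∈ Set.Ioo (0 : ℝ) 1) (I : Set ℝ) (hI : Convex ℝ I)
    (f : ℝ → ℝ) (hf : ConvexOn ℝ I f) (a b : ℝ) (ha : a ∈ I) (hb : b ∈ I)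
    (hcont : ContinuousOn f (segment ℝ a b))
    (c : ℝ) (hc : c = (1 - l) * a + l * b) :
    f c ≤
      (∫ x in (0 : ℝ)..1, f ((c + ((1 - x) * a + x * b)) / 2) *
        (l / (1 - l) * x ^ ((2 * l - 1) / (1 - l)))) ∧
    (∫ x in (0 : ℝ)..1, f ((c + ((1 - x) * a + x * b)) / 2) *
        (l / (1 - l) * x ^ ((2 * l - 1) / (1 - l)))) ≤
      (∫ x in (0 : ℝ)..1,
        ((1 / 2) * (∫ t in (0 : ℝ)..1, f ((1 - t) * c + t * ((1 - x) * a + x * b)) *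
            (l / (1 - l) * t ^ ((2 * l - 1) / (1 - l)))) +
         (1 / 2) * (∫ t in (0 : ℝ)..1, f ((1 - t) * c + t * ((1 - x) * a + x * b)) *
            ((1 - l) / l * t ^ ((2 * (1 - l) - 1) / (1 - (1 - l)))))) *
        (l / (1 - l) * x ^ ((2 * l - 1) / (1 - l)))) ∧
    (∫ x in (0 : ℝ)..1,
        ((1 / 2) * (∫ t in (0 : ℝ)..1, f ((1 - t) * c + t * ((1 - x) * a + x * b)) *
            (l / (1 - l) * t ^ ((2 * l - 1) / (1 - l)))) +
         (1 / 2) * (∫ t in (0 : ℝ)..1, f ((1 - t) * c + t * ((1 - x) * a + x * b)) *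
            ((1 - l) / l * t ^ ((2 * (1 - l) - 1) / (1 - (1 - l)))))) *
        (l / (1 - l) * x ^ ((2 * l - 1) / (1 - l)))) ≤
      (1 / 2) * f c + (1 / 2) * (∫ x in (0 : ℝ)..1, f ((1 - x) * a + x * b) *
        (l / (1 - l) * x ^ ((2 * l - 1) / (1 - l)))) ∧
    (1 / 2) * f c + (1 / 2) * (∫ x in (0 : ℝ)..1, f ((1 - x) * a + x * b) *
        (l / (1 - l) * x ^ ((2 * l - 1) / (1 - l)))) ≤
      (∫ x in (0 : ℝ)..1, f ((1 - x) * a + x * b) *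
        (l / (1 - l) * x ^ ((2 * l - 1) / (1 - l)))) := by
  have hl' : 1 - l ∈ Ioo (0 : ℝ) 1 := ⟨sub_pos.2 hl.2, sub_lt_self 1 hl.1⟩
  have hlI : l ∈ Icc (0 : ℝ) 1 := Ioo_subset_Icc_self hl
  set g : ℝ → ℝ := fun x ↦ f ((1 - x) * a + x * b) with hg
  have hgconv : ConvexOn ℝ (Icc 0 1) g := hf.comp_lineMap_Icc ha hb
  have hgcont : ContinuousOn g (Icc 0 1) := by
    refine hcont.comp (by fun_prop) fun x hx ↦ ?_
    exact ⟨1 - x, x, sub_nonneg.2 hx.2, hx.1, sub_add_cancel 1 x, rfl⟩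
  set h : ℝ → ℝ := IccExtend (zero_le_one' ℝ) ((Icc 0 1).domRestrict g) with hh
  have hgh : ∀ x ∈ Icc (0 : ℝ) 1, g x = h x := fun x hx ↦ by
    rw [hh, IccExtend_of_mem _ _ hx, domRestrict_apply]
  have hhcont : Continuous h := hgcont.domRestrict.Icc_extend'
  have hhconv : ConvexOn ℝ (Icc 0 1) h := hgconv.congr hgh
  obtain ⟨C, hC⟩ := isCompact_Icc.exists_bound_of_continuousOn hgcont
  have hhC : ∀ x, |h x| ≤ C := fun x ↦ hC _ (projIcc 0 1 (zero_le_one' ℝ) x).2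
  have hfc : f c = h l := by rw [← hgh l hlI, hg, hc]
  have hfx : ∀ x ∈ Icc (0 : ℝ) 1, f ((1 - x) * a + x * b) = h x := hgh
  have hfmid : ∀ x ∈ Icc (0 : ℝ) 1, f ((c + ((1 - x) * a + x * b)) / 2) = h ((l + x) / 2) := by
    intro x hx
    rw [← hgh _ ⟨by linarith [hl.1, hx.1], by linarith [hl.2, hx.2]⟩, hg, hc]
    ring_nf
  have hfline : ∀ x ∈ Icc (0 : ℝ) 1, ∀ t ∈ Icc (0 : ℝ) 1,
      f ((1 - t) * c + t * ((1 - x) * a + x * b)) = h ((1 - t) * l + t * x) := by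
    intro x hx t ht
    have hmem : (1 - t) * l + t * x ∈ Icc (0 : ℝ) 1 :=
      convex_Icc (0 : ℝ) 1 hlI hx (sub_nonneg.2 ht.2) ht.1 (sub_add_cancel 1 t)
    rw [← hgh _ hmem, hg, hc]
    ring_nf
  have hinner : ∀ x ∈ Icc (0 : ℝ) 1,
      (1 / 2) * (∫ t in (0 : ℝ)..1, f ((1 - t) * c + t * ((1 - x) * a + x * b)) *
          (l / (1 - l) * t ^ ((2 * l - 1) / (1 - l)))) +
        (1 / 2) * (∫ t in (0 : ℝ)..1, f ((1 - t) * c + t * ((1 - x) * a + x * b)) *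
          ((1 - l) / l * t ^ ((2 * (1 - l) - 1) / (1 - (1 - l))))) =
      ((1 / 2) * ∫ t, h ((1 - t) * l + t * x) ∂powerMeasure l) +
        (1 / 2) * ∫ t, h ((1 - t) * l + t * x) ∂powerMeasure (1 - l) := by
    intro x hx
    rw [← intervalIntegral_eq_integral_powerMeasure hl (hfline x hx),
      ← intervalIntegral_eq_integral_powerMeasure hl' (hfline x hx), sub_sub_cancel]
  rw [intervalIntegral_eq_integral_powerMeasure hl hfmid,
    intervalIntegral_eq_integral_powerMeasure hl hinner,
    intervalIntegral_eq_integral_powerMeasure hl hfx, hfc]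
  exact hhconv.hermiteHadamard_chain_powerMeasure hl hhcont hhC
end

section
/- Let I ⊆ ℝ be an interval, f : ℝ → ℝ convex on I, a, b ∈ I, and s, t ∈ (0,1). Set m(s,t) = min(t/s, (1-t)/(1-s)) and M(s,t) = max(t/s, (1-t)/(1-s)). Then m(s,t)·((1-s)f(a) + sf(b) - f((1-s)a+sb)) ≤ (1-t)f(a) + tf(b) - f((1-t)a+tb) ≤ M(s,t)·((1-s)f(a) + sf(b) - f((1-s)a+sb)). -/
/-- If `c * s ≤ t` and `c * (1 - s) ≤ 1 - t` with `0 ≤ c`, then `c` times the convexity defect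
at `s` is at most the defect at `t`. -/
theorem ConvexOn.mul_defect_le_defect {I : Set ℝ} {f : ℝ → ℝ} (hf : ConvexOn ℝ I f)
    {a b : ℝ} (ha : a ∈ I) (hb : b ∈ I) {s t c : ℝ} (hs₀ : 0 ≤ s) (hs₁ : s ≤ 1) (hc : 0 ≤ c)
    (hct : c * s ≤ t) (hct' : c * (1 - s) ≤ 1 - t) :
    c * ((1 - s) * f a + s * f b - f ((1 - s) * a + s * b)) ≤
      (1 - t) * f a + t * f b - f ((1 - t) * a + t * b) := by
  have hp : (1 - s) * a + s * b ∈ I :=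
    hf.1 ha hb (sub_nonneg.2 hs₁) hs₀ (sub_add_cancel 1 s)
  have jensen := hf.map_sum_le (t := Finset.univ)
    (w := ![c, 1 - t - c * (1 - s), t - c * s]) (p := ![(1 - s) * a + s * b, a, b])
    (by simp [Fin.forall_fin_succ, hc, hct, hct'])
    (by simp only [Fin.sum_univ_three, Matrix.cons_val]; ring)
    (by simp [Fin.forall_fin_succ, hp, ha, hb])
  simp only [Fin.sum_univ_three, Matrix.cons_val, smul_eq_mul] at jensen
  have hcomb : c * ((1 - s) * a + s * b) + (1 - t - c * (1 - s)) * a + (t - c * s) * b =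
      (1 - t) * a + t * b := by ring
  rw [hcomb] at jensen
  linarith

/-- Scalar refinement/reverse of the convexity inequality: the defect at parameter `t`
is controlled by the defect at parameter `s` via `m(s,t)` and `M(s,t)`. -/
theorem stmt_8 (I : Set ℝ) (hI : Convex ℝ I) (f : ℝ → ℝ) (hf : ConvexOn ℝ I f)
    (a b : ℝ) (ha : a ∈ I) (hb : b ∈ I)
    (s t : ℝ) (hs : s ∈ Set.Ioo (0 : ℝ) 1) (ht : t ∈ Set.Ioo (0 : ℝ) 1) :
    min (t / s) ((1 - t) / (1 - s)) *
        ((1 - s) * f a + s * f b - f ((1 - s) * a + s * b)) ≤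
      (1 - t) * f a + t * f b - f ((1 - t) * a + t * b) ∧
    (1 - t) * f a + t * f b - f ((1 - t) * a + t * b) ≤
      max (t / s) ((1 - t) / (1 - s)) *
        ((1 - s) * f a + s * f b - f ((1 - s) * a + s * b)) := by
  obtain ⟨hs₀, hs₁⟩ := hs
  obtain ⟨ht₀, ht₁⟩ := ht
  have hs' : 0 < 1 - s := sub_pos.2 hs₁
  have ht' : 0 < 1 - t := sub_pos.2 ht₁
  constructor
  · exact hf.mul_defect_le_defect ha hb hs₀.le hs₁.le
      (le_min (div_pos ht₀ hs₀).le (div_pos ht' hs').le)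
      ((le_div_iff₀ hs₀).1 (min_le_left _ _)) ((le_div_iff₀ hs').1 (min_le_right _ _))
  · have hM : 0 < max (t / s) ((1 - t) / (1 - s)) := lt_max_of_lt_left (div_pos ht₀ hs₀)
    rw [← inv_mul_le_iff₀ hM]
    exact hf.mul_defect_le_defect ha hb ht₀.le ht₁.le (inv_pos.2 hM).le
      ((inv_mul_le_iff₀ hM).2 ((div_le_iff₀ hs₀).1 (le_max_left _ _)))
      ((inv_mul_le_iff₀ hM).2 ((div_le_iff₀ hs').1 (le_max_right _ _)))
end

section
/- For any s, λ ∈ (0,1), ∫₀¹ min(t/s, (1-t)/(1-s))·(λ/(1-λ))·t^((2λ-1)/(1-λ)) dt = ((1-λ)/(1-s))·(1 - s^(λ/(1-λ))). -/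
/-- The integral over `[0, 1]` of the tent function with peak at `s` against the density
`t ↦ a * t ^ (a - 1)`. -/
theorem integral_tent_mul_rpow {s a : ℝ} (hs : s ∈ Set.Ioo (0 : ℝ) 1) (ha : 0 < a) :
    ∫ t in (0 : ℝ)..1, min (t / s) ((1 - t) / (1 - s)) * (a * t ^ (a - 1)) =
      (1 - s ^ a) / ((a + 1) * (1 - s)) := by
  obtain ⟨hs0, hs1⟩ := hs
  have h1s : 0 < 1 - s := sub_pos.2 hs1
  have hint (r b c : ℝ) (hr : -1 < r) :
      IntervalIntegrable (fun t : ℝ => t ^ r) MeasureTheory.volume b c :=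
    intervalIntegral.intervalIntegrable_rpow' hr
  have hleft : Set.EqOn (fun t : ℝ => a / s * t ^ a)
      (fun t => min (t / s) ((1 - t) / (1 - s)) * (a * t ^ (a - 1))) (Set.uIoc 0 s) := by
    intro t ht
    rw [Set.uIoc_of_le hs0.le] at ht
    have hmin : t / s ≤ (1 - t) / (1 - s) := by
      rw [div_le_div_iff₀ hs0 h1s]
      nlinarith [ht.2]
    have ht0 := ht.1
    simp only [min_eq_left hmin, Real.rpow_sub_one ht0.ne']
    field_simp
  have hright : Set.EqOn (fun t : ℝ => a / (1 - s) * (t ^ (a - 1) - t ^ a))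
      (fun t => min (t / s) ((1 - t) / (1 - s)) * (a * t ^ (a - 1))) (Set.uIoc s 1) := by
    intro t ht
    rw [Set.uIoc_of_le hs1.le] at ht
    have hmin : (1 - t) / (1 - s) ≤ t / s := by
      rw [div_le_div_iff₀ h1s hs0]
      nlinarith [ht.1]
    have ht0 : 0 < t := hs0.trans ht.1
    simp only [min_eq_right hmin, Real.rpow_sub_one ht0.ne']
    field_simp
  have hint_left := ((hint a 0 s (by linarith)).const_mul (a / s)).congr hleft
  have hint_right := (((hint (a - 1) s 1 (by linarith)).sub
    (hint a s 1 (by linarith))).const_mul (a / (1 - s))).congr hright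
  rw [← intervalIntegral.integral_add_adjacent_intervals hint_left hint_right,
    ← intervalIntegral.integral_congr_ae (Filter.Eventually.of_forall fun _ ht => hleft ht),
    ← intervalIntegral.integral_congr_ae (Filter.Eventually.of_forall fun _ ht => hright ht),
    intervalIntegral.integral_const_mul, intervalIntegral.integral_const_mul,
    intervalIntegral.integral_sub (hint _ _ _ (by linarith)) (hint _ _ _ (by linarith)),
    integral_rpow (Or.inl (by linarith)), integral_rpow (Or.inl (by linarith)),
    integral_rpow (Or.inl (by linarith)), sub_add_cancel, Real.rpow_add_one hs0.ne',
    Real.zero_rpow (by linarith), Real.one_rpow, Real.one_rpow]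
  have ha1 : a + 1 ≠ 0 := by linarith
  field_simp
  ring

/-- `∫₀¹ m(s,t) dη_λ(t) = ((1-λ)/(1-s))(1 - s^(λ/(1-λ)))` for `s, λ ∈ (0,1)`. -/
theorem stmt_9 (s l : ℝ) (hs : s ∈ Set.Ioo (0 : ℝ) 1) (hl : l ∈ Set.Ioo (0 : ℝ) 1) :
    (∫ t in (0 : ℝ)..1, min (t / s) ((1 - t) / (1 - s)) *
        (l / (1 - l) * t ^ ((2 * l - 1) / (1 - l)))) =
      (1 - l) / (1 - s) * (1 - s ^ (l / (1 - l))) := by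
  have h1l : 0 < 1 - l := sub_pos.2 hl.2
  have hexp : (2 * l - 1) / (1 - l) = l / (1 - l) - 1 := by
    field_simp
    ring
  have hadd : l / (1 - l) + 1 = (1 - l)⁻¹ := by
    field_simp
    ring
  rw [hexp, integral_tent_mul_rpow hs (div_pos hl.1 h1l), hadd]
  have h1s : 0 < 1 - s := sub_pos.2 hs.2
  field_simp
end

section
/- For any s, λ ∈ (0,1), ∫₀¹ max(t/s, (1-t)/(1-s))·(λ/(1-λ))·t^((2λ-1)/(1-λ)) dt = (1-λ)/(1-s) + λ/s - ((1-λ)/(1-s))·(1 - s^(λ/(1-λ))). -/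
/-- The value of the integral of `max (t / s) ((1 - t) / (1 - s))` against the density
`a * t ^ (a - 1)` on `[0, 1]`. -/
theorem integral_max_mul_rpow {s a : ℝ} (hs0 : 0 < s) (hs1 : s < 1) (ha : 0 < a) :
    (∫ t in (0 : ℝ)..1, max (t / s) ((1 - t) / (1 - s)) * (a * t ^ (a - 1))) =
      (s ^ a - a / (a + 1) * s ^ (a + 1)) / (1 - s) + a / (a + 1) * (1 - s ^ (a + 1)) / s := by
  have h1s : 0 < 1 - s := sub_pos.2 hs1
  have hrpow (r : ℝ) (hr : -1 < r) (x y : ℝ) :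
      IntervalIntegrable (fun t : ℝ => t ^ r) MeasureTheory.volume x y :=
    intervalIntegral.intervalIntegrable_rpow' hr
  have hadd {t : ℝ} (ht : 0 < t) : t ^ a = t * t ^ (a - 1) := by
    rw [Real.rpow_sub_one ht.ne']
    field_simp
  have hleft : Set.EqOn (fun t : ℝ => a / (1 - s) * t ^ (a - 1) - a / (1 - s) * t ^ a)
      (fun t => max (t / s) ((1 - t) / (1 - s)) * (a * t ^ (a - 1))) (Set.uIoc 0 s) := by
    intro t ht
    rw [Set.uIoc_of_le hs0.le] at ht
    have hmax : t / s ≤ (1 - t) / (1 - s) := by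
      rw [div_le_div_iff₀ hs0 h1s]
      nlinarith [ht.2]
    simp only [max_eq_right hmax, hadd ht.1]
    ring
  have hright : Set.EqOn (fun t : ℝ => a / s * t ^ a)
      (fun t => max (t / s) ((1 - t) / (1 - s)) * (a * t ^ (a - 1))) (Set.uIoc s 1) := by
    intro t ht
    rw [Set.uIoc_of_le hs1.le] at ht
    have hmax : (1 - t) / (1 - s) ≤ t / s := by
      rw [div_le_div_iff₀ h1s hs0]
      nlinarith [ht.1]
    simp only [max_eq_left hmax, hadd (hs0.trans ht.1)]
    ring
  have hi1 := (hrpow (a - 1) (by linarith) 0 s).const_mul (a / (1 - s))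
  have hi2 := (hrpow a (by linarith) 0 s).const_mul (a / (1 - s))
  have hi3 := (hrpow a (by linarith) s 1).const_mul (a / s)
  rw [← intervalIntegral.integral_add_adjacent_intervals ((hi1.sub hi2).congr hleft)
      (hi3.congr hright),
    ← intervalIntegral.integral_congr_ae (.of_forall hleft),
    ← intervalIntegral.integral_congr_ae (.of_forall hright),
    intervalIntegral.integral_sub hi1 hi2]
  simp only [intervalIntegral.integral_const_mul]
  rw [integral_rpow (Or.inl (by linarith)), integral_rpow (Or.inl (by linarith)),
    integral_rpow (Or.inl (by linarith)), sub_add_cancel, Real.zero_rpow ha.ne',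
    Real.zero_rpow (by positivity), Real.one_rpow]
  have ha1 : a + 1 ≠ 0 := by positivity
  field_simp
  ring

/-- `∫₀¹ M(s,t) dη_λ(t) = (1-λ)/(1-s) + λ/s - ((1-λ)/(1-s))(1 - s^(λ/(1-λ)))`
for `s, λ ∈ (0,1)`. -/
theorem stmt_10 (s l : ℝ) (hs : s ∈ Set.Ioo (0 : ℝ) 1) (hl : l ∈ Set.Ioo (0 : ℝ) 1) :
    (∫ t in (0 : ℝ)..1, max (t / s) ((1 - t) / (1 - s)) *
        (l / (1 - l) * t ^ ((2 * l - 1) / (1 - l)))) =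
      (1 - l) / (1 - s) + l / s - (1 - l) / (1 - s) * (1 - s ^ (l / (1 - l))) := by
  obtain ⟨hs0, hs1⟩ := hs
  obtain ⟨hl0, hl1⟩ := hl
  have h1s : 1 - s ≠ 0 := (sub_pos.2 hs1).ne'
  have h1l : 1 - l ≠ 0 := (sub_pos.2 hl1).ne'
  have hexp : (2 * l - 1) / (1 - l) = l / (1 - l) - 1 := by
    field_simp
    ring
  have hratio : l / (1 - l) / (l / (1 - l) + 1) = l := by
    have : l / (1 - l) + 1 = 1 / (1 - l) := by
      field_simp
      ring
    rw [this]
    field_simp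
  rw [hexp, integral_max_mul_rpow hs0 hs1 (div_pos hl0 (sub_pos.2 hl1)), hratio,
    Real.rpow_add_one hs0.ne']
  generalize s ^ (l / (1 - l)) = x
  field_simp
  ring
end

section
/- Let s, λ ∈ (0,1), let I ⊆ ℝ be an interval, f : ℝ → ℝ convex on I and continuous on the segment joining a and b, where a, b ∈ I. Set α(s,λ) = ((1-λ)/(1-s))·(1 - s^(λ/(1-λ))) and μ(s,λ) = (1-λ)/(1-s) + λ/s - α(s,λ). Then α(s,λ)·((1-s)f(a)+sf(b) - f((1-s)a+sb)) ≤ (1-λ)f(a)+λf(b) - ∫₀¹ f((1-t)a+tb) dη_λ(t) ≤ μ(s,λ)·((1-s)f(a)+sf(b) - f((1-s)a+sb)). -/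
open intervalIntegral in
theorem integral_affine_mul_rpow {l u v : ℝ} (hl : l ∈ Set.Ioo (0 : ℝ) 1) (hu : 0 ≤ u)
    (hv : 0 ≤ v) (A B : ℝ) :
    ∫ t in u..v, (A + B * t) * (l / (1 - l) * t ^ ((2 * l - 1) / (1 - l))) =
      A * (v ^ (l / (1 - l)) - u ^ (l / (1 - l))) +
        B * l * (v ^ (l / (1 - l)) * v - u ^ (l / (1 - l)) * u) := by
  obtain ⟨hl0, hl1⟩ := hl
  have h1l : 0 < 1 - l := by linarith
  obtain ⟨p, hp⟩ : ∃ p, p = l / (1 - l) := ⟨_, rfl⟩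
  have hp0 : 0 < p := hp ▸ div_pos hl0 h1l
  have hexp : (2 * l - 1) / (1 - l) = p - 1 := by rw [hp]; field_simp; ring
  have hlp : l * (p + 1) = p := by rw [hp]; field_simp; ring
  have hpow : ∀ x : ℝ, 0 ≤ x → x ^ (p + 1) = x ^ p * x := fun x hx =>
    Real.rpow_add_one' hx (by positivity)
  rw [hexp, ← hp]
  have hcongr : ∫ t in u..v, (A + B * t) * (p * t ^ (p - 1)) =
      ∫ t in u..v, (A * p * t ^ (p - 1) + B * p * t ^ p) := by
    refine integral_congr fun t ht => ?_
    have ht0 : 0 ≤ t := (le_min hu hv).trans ht.1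
    have : t ^ p = t ^ (p - 1) * t := by
      simpa using Real.rpow_add_one' (y := p - 1) ht0 (by simpa using hp0.ne')
    simp only [this]
    ring
  rw [hcongr, integral_add ((intervalIntegrable_rpow' (by linarith)).const_mul _)
    ((intervalIntegrable_rpow' (by linarith)).const_mul _), integral_const_mul,
    integral_const_mul, integral_rpow (Or.inl (by linarith)),
    integral_rpow (Or.inl (by linarith)), hpow u hu, hpow v hv, sub_add_cancel]
  field_simp
  linear_combination (-B * (v ^ p * v - u ^ p * u)) * hlp

theorem intervalIntegrable_mul_rpow_weight {l u v : ℝ} (hl : l ∈ Set.Ioo (0 : ℝ) 1)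
    {g : ℝ → ℝ} (hg : ContinuousOn g (Set.uIcc u v)) :
    IntervalIntegrable (fun t => g t * (l / (1 - l) * t ^ ((2 * l - 1) / (1 - l))))
      MeasureTheory.volume u v := by
  obtain ⟨hl0, hl1⟩ := hl
  refine IntervalIntegrable.continuousOn_mul ?_ hg
  refine (intervalIntegral.intervalIntegrable_rpow' ?_).const_mul _
  rw [lt_div_iff₀ (by linarith)]
  linarith

theorem ConcaveOn.mul_le_mul_of_left_endpoint {D : ℝ → ℝ}
    (hD : ConcaveOn ℝ (Set.Icc 0 1) D) (h0 : D 0 = 0) {x y : ℝ} (hx : 0 ≤ x) (hxy : x ≤ y)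
    (hy : 0 < y) (hy1 : y ≤ 1) : x / y * D y ≤ D x := by
  have h := hD.2 (x := y) ⟨hy.le, hy1⟩
    (Set.left_mem_Icc.2 zero_le_one) (div_nonneg hx hy.le)
    (sub_nonneg.2 ((div_le_one hy).2 hxy)) (add_sub_cancel _ _)
  simpa [h0, div_mul_cancel₀ x hy.ne'] using h

theorem ConcaveOn.mul_le_mul_of_right_endpoint {D : ℝ → ℝ}
    (hD : ConcaveOn ℝ (Set.Icc 0 1) D) (h1 : D 1 = 0) {x y : ℝ} (hx : 0 ≤ x) (hxy : x ≤ y)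
    (hx1 : x < 1) (hy1 : y ≤ 1) : (1 - y) / (1 - x) * D x ≤ D y := by
  have hpos : 0 < 1 - x := sub_pos.2 hx1
  have h := hD.2 (x := x) ⟨hx, hx1.le⟩ (Set.right_mem_Icc.2 zero_le_one)
    (div_nonneg (sub_nonneg.2 hy1) hpos.le)
    (sub_nonneg.2 ((div_le_one hpos).2 (by linarith : 1 - y ≤ 1 - x))) (add_sub_cancel _ _)
  have hy : (1 - y) / (1 - x) * x + (1 - (1 - y) / (1 - x)) = y := by field_simp; ring
  simpa [h1, hy] using h

theorem integral_mul_rpow_weight_mono {l u v : ℝ} (hl : l ∈ Set.Ioo (0 : ℝ) 1) (hu : 0 ≤ u)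
    (huv : u ≤ v) {g h : ℝ → ℝ} (hg : ContinuousOn g (Set.Icc u v))
    (hh : ContinuousOn h (Set.Icc u v)) (hgh : ∀ t ∈ Set.Ioo u v, g t ≤ h t) :
    ∫ t in u..v, g t * (l / (1 - l) * t ^ ((2 * l - 1) / (1 - l))) ≤
      ∫ t in u..v, h t * (l / (1 - l) * t ^ ((2 * l - 1) / (1 - l))) := by
  rw [← Set.uIcc_of_le huv] at hg hh
  refine intervalIntegral.integral_mono_on_of_le_Ioo huv
    (intervalIntegrable_mul_rpow_weight hl hg) (intervalIntegrable_mul_rpow_weight hl hh)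
    fun t ht => mul_le_mul_of_nonneg_right (hgh t ht) ?_
  exact mul_nonneg (div_nonneg hl.1.le (sub_nonneg.2 hl.2.le))
    (Real.rpow_nonneg (hu.trans ht.1.le) _)

/-- Bounds for the weighted integral of a concave function vanishing at both endpoints. -/
theorem ConcaveOn.integral_mul_rpow_weight_bounds {s l : ℝ} (hs : s ∈ Set.Ioo (0 : ℝ) 1)
    (hl : l ∈ Set.Ioo (0 : ℝ) 1) {D : ℝ → ℝ} (hD : ConcaveOn ℝ (Set.Icc 0 1) D)
    (hc : ContinuousOn D (Set.Icc 0 1)) (h0 : D 0 = 0) (h1 : D 1 = 0) :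
    (1 - l) / (1 - s) * (1 - s ^ (l / (1 - l))) * D s ≤
      (∫ t in (0 : ℝ)..1, D t * (l / (1 - l) * t ^ ((2 * l - 1) / (1 - l)))) ∧
    (∫ t in (0 : ℝ)..1, D t * (l / (1 - l) * t ^ ((2 * l - 1) / (1 - l)))) ≤
      ((1 - l) / (1 - s) + l / s - (1 - l) / (1 - s) * (1 - s ^ (l / (1 - l)))) * D s := by
  obtain ⟨hs0, hs1⟩ := hs
  have hs1' : 0 < 1 - s := sub_pos.2 hs1
  have hc1 : ContinuousOn D (Set.Icc 0 s) := hc.mono (Set.Icc_subset_Icc le_rfl hs1.le)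
  have hc2 : ContinuousOn D (Set.Icc s 1) := hc.mono (Set.Icc_subset_Icc hs0.le le_rfl)
  have hp : l / (1 - l) ≠ 0 := (div_pos hl.1 (sub_pos.2 hl.2)).ne'
  rw [← intervalIntegral.integral_add_adjacent_intervals
    (intervalIntegrable_mul_rpow_weight hl (by rwa [Set.uIcc_of_le hs0.le]))
    (intervalIntegrable_mul_rpow_weight hl (by rwa [Set.uIcc_of_le hs1.le]))]
  have hcont : ∀ (A B : ℝ) (S : Set ℝ), ContinuousOn (fun t : ℝ => A + B * t) S :=
    fun A B S => by fun_prop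
  have left_lower := integral_mul_rpow_weight_mono hl le_rfl hs0.le
    (hcont 0 (D s / s) _) hc1 fun t ht => by
      refine le_of_eq_of_le ?_ (hD.mul_le_mul_of_left_endpoint h0 ht.1.le ht.2.le hs0 hs1.le)
      ring
  have left_upper := integral_mul_rpow_weight_mono hl le_rfl hs0.le hc1
    (hcont (D s / (1 - s)) (-(D s / (1 - s))) _) fun t ht => by
      have ht1 : 0 < 1 - t := sub_pos.2 (ht.2.trans hs1)
      have h := hD.mul_le_mul_of_right_endpoint h1 ht.1.le ht.2.le (ht.2.trans hs1) hs1.le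
      rw [div_mul_eq_mul_div, div_le_iff₀ ht1] at h
      have heq : D s / (1 - s) + -(D s / (1 - s)) * t = D s * (1 - t) / (1 - s) := by ring
      rw [heq, le_div_iff₀ hs1']
      linarith
  have right_lower := integral_mul_rpow_weight_mono hl hs0.le hs1.le
    (hcont (D s / (1 - s)) (-(D s / (1 - s))) _) hc2 fun t ht => by
      refine le_of_eq_of_le ?_ (hD.mul_le_mul_of_right_endpoint h1 hs0.le ht.1.le hs1 ht.2.le)
      ring
  have right_upper := integral_mul_rpow_weight_mono hl hs0.le hs1.le hc2
    (hcont 0 (D s / s) _) fun t ht => by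
      have ht0 : 0 < t := hs0.trans ht.1
      have h := hD.mul_le_mul_of_left_endpoint h0 hs0.le ht.1.le ht0 ht.2.le
      rw [div_mul_eq_mul_div, div_le_iff₀ ht0] at h
      rw [zero_add, div_mul_eq_mul_div, le_div_iff₀ hs0]
      linarith
  rw [integral_affine_mul_rpow hl le_rfl hs0.le] at left_lower left_upper
  rw [integral_affine_mul_rpow hl hs0.le zero_le_one] at right_lower right_upper
  simp only [Real.zero_rpow hp, Real.one_rpow] at left_lower left_upper right_lower right_upper
  constructor
  · refine le_of_eq_of_le ?_ (add_le_add left_lower right_lower)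
    field_simp
    ring
  · refine (add_le_add left_upper right_upper).trans_eq ?_
    field_simp
    ring


/-- Scalar case of Theorem 2.10: refinement and reverse of the right weighted
Hermite–Hadamard inequality, with `α(s,λ) = ((1-λ)/(1-s))(1-s^(λ/(1-λ)))` and
`μ(s,λ) = (1-λ)/(1-s) + λ/s - α(s,λ)`. -/
theorem stmt_11 (s l : ℝ) (hs : s ∈ Set.Ioo (0 : ℝ) 1) (hl : l ∈ Set.Ioo (0 : ℝ) 1)
    (I : Set ℝ) (hI : Convex ℝ I) (f : ℝ → ℝ) (hf : ConvexOn ℝ I f)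
    (a b : ℝ) (ha : a ∈ I) (hb : b ∈ I) (hcont : ContinuousOn f (segment ℝ a b)) :
    (1 - l) / (1 - s) * (1 - s ^ (l / (1 - l))) *
        ((1 - s) * f a + s * f b - f ((1 - s) * a + s * b)) ≤
      (1 - l) * f a + l * f b -
        (∫ t in (0 : ℝ)..1, f ((1 - t) * a + t * b) *
          (l / (1 - l) * t ^ ((2 * l - 1) / (1 - l)))) ∧
    (1 - l) * f a + l * f b -
        (∫ t in (0 : ℝ)..1, f ((1 - t) * a + t * b) *
          (l / (1 - l) * t ^ ((2 * l - 1) / (1 - l)))) ≤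
      ((1 - l) / (1 - s) + l / s - (1 - l) / (1 - s) * (1 - s ^ (l / (1 - l)))) *
        ((1 - s) * f a + s * f b - f ((1 - s) * a + s * b)) := by
  have hmaps : ∀ t ∈ Set.Icc (0 : ℝ) 1, (1 - t) * a + t * b ∈ segment ℝ a b := fun t ht =>
    ⟨1 - t, t, sub_nonneg.2 ht.2, ht.1, by ring, by simp⟩
  have hsub : segment ℝ a b ⊆ I := hI.segment_subset ha hb
  have hgc : ContinuousOn (fun t : ℝ => f ((1 - t) * a + t * b)) (Set.Icc 0 1) :=
    hcont.comp (by fun_prop) hmaps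
  have hDc : ContinuousOn (fun t : ℝ => (1 - t) * f a + t * f b - f ((1 - t) * a + t * b))
      (Set.Icc 0 1) := ContinuousOn.sub (by fun_prop) hgc
  have hD : ConcaveOn ℝ (Set.Icc 0 1)
      (fun t : ℝ => (1 - t) * f a + t * f b - f ((1 - t) * a + t * b)) := by
    refine ⟨convex_Icc 0 1, fun x hx y hy c d hc hd hcd => ?_⟩
    have h := hf.2 (hsub (hmaps x hx)) (hsub (hmaps y hy)) hc hd hcd
    simp only [smul_eq_mul] at h ⊢
    have hpt : c * ((1 - x) * a + x * b) + d * ((1 - y) * a + y * b) =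
        (1 - (c * x + d * y)) * a + (c * x + d * y) * b := by
      linear_combination a * hcd
    rw [hpt] at h
    linear_combination h + f a * hcd
  have key := hD.integral_mul_rpow_weight_bounds hs hl hDc (by simp) (by simp)
  have hint : ∫ t in (0 : ℝ)..1, ((1 - t) * f a + t * f b - f ((1 - t) * a + t * b)) *
      (l / (1 - l) * t ^ ((2 * l - 1) / (1 - l))) =
      (1 - l) * f a + l * f b - ∫ t in (0 : ℝ)..1, f ((1 - t) * a + t * b) *
        (l / (1 - l) * t ^ ((2 * l - 1) / (1 - l))) := by
    have haff := integral_affine_mul_rpow hl le_rfl zero_le_one (f a) (f b - f a)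
    rw [Real.zero_rpow (div_pos hl.1 (sub_pos.2 hl.2)).ne', Real.one_rpow] at haff
    have hval : (1 - l) * f a + l * f b =
        ∫ t in (0 : ℝ)..1, (f a + (f b - f a) * t) *
          (l / (1 - l) * t ^ ((2 * l - 1) / (1 - l))) := by
      rw [haff]
      ring
    rw [hval, ← intervalIntegral.integral_sub
      (intervalIntegrable_mul_rpow_weight hl (by fun_prop))
      (intervalIntegrable_mul_rpow_weight hl (by rwa [Set.uIcc_of_le zero_le_one]))]
    congr 1
    ext t
    ring
  rwa [hint] at key
end

section
/- Let λ ∈ (0,1), let I ⊆ ℝ be an interval, f : ℝ → ℝ convex on I and continuous on the segment joining a and b, where a, b ∈ I. Then (1 - λ^(λ/(1-λ)))·((1-λ)f(a)+λf(b) - f((1-λ)a+λb)) ≤ (1-λ)f(a)+λf(b) - ∫₀¹ f((1-t)a+tb) dη_λ(t) ≤ (1 + λ^(λ/(1-λ)))·((1-λ)f(a)+λf(b) - f((1-λ)a+λb)). -/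
open MeasureTheory intervalIntegral

/-- Three-point form of convexity, without division. -/
theorem ConvexOn.sub_mul_le_sub_mul_add_sub_mul {s : Set ℝ} {F : ℝ → ℝ} (hF : ConvexOn ℝ s F)
    {x y z : ℝ} (hx : x ∈ s) (hz : z ∈ s) (hxy : x ≤ y) (hyz : y ≤ z) :
    (z - x) * F y ≤ (z - y) * F x + (y - x) * F z := by
  rcases (hxy.trans hyz).eq_or_lt with h | h
  · obtain rfl : x = y := le_antisymm hxy (h ▸ hyz)
    subst h
    simp
  · have hpos : 0 < z - x := sub_pos.2 h
    have key := hF.2 hx hz (div_nonneg (sub_nonneg.2 hyz) hpos.le)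
      (div_nonneg (sub_nonneg.2 hxy) hpos.le) (by field_simp; ring)
    have hy : ((z - y) / (z - x)) • x + ((y - x) / (z - x)) • z = y := by
      simp only [smul_eq_mul]
      field_simp
      ring
    rw [hy, smul_eq_mul, smul_eq_mul] at key
    calc (z - x) * F y
        ≤ (z - x) * ((z - y) / (z - x) * F x + (y - x) / (z - x) * F z) :=
          mul_le_mul_of_nonneg_left key hpos.le
      _ = (z - y) * F x + (y - x) * F z := by field_simp

theorem intervalIntegrable_mul_const_mul_rpow {F : ℝ → ℝ} {c x y : ℝ} (hc : 0 < c)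
    (hF : ContinuousOn F (Set.uIcc x y)) :
    IntervalIntegrable (fun t => F t * (c * t ^ (c - 1))) volume x y :=
  ((intervalIntegrable_rpow' (by linarith)).const_mul c).continuousOn_mul hF

theorem integral_affine_mul_const_mul_rpow {c x y : ℝ} (hc : 0 < c) (hx : 0 ≤ x) (hxy : x ≤ y)
    (p q : ℝ) :
    ∫ t in x..y, (p + q * t) * (c * t ^ (c - 1)) =
      p * (y ^ c - x ^ c) + q * (c / (c + 1)) * (y ^ (c + 1) - x ^ (c + 1)) := by
  have h : ∫ t in x..y, (p + q * t) * (c * t ^ (c - 1)) =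
      ∫ t in x..y, (p * c * t ^ (c - 1) + q * c * t ^ c) := by
    refine integral_congr_ae (Filter.Eventually.of_forall fun t ht => ?_)
    rw [Set.uIoc_of_le hxy] at ht
    have ht0 : 0 < t := hx.trans_lt ht.1
    rw [Real.rpow_sub_one ht0.ne']
    field_simp
  rw [h, integral_add ((intervalIntegrable_rpow' (by linarith)).const_mul _)
      ((intervalIntegrable_rpow' (by linarith)).const_mul _),
    intervalIntegral.integral_const_mul, intervalIntegral.integral_const_mul,
    integral_rpow (Or.inl (by linarith)), integral_rpow (Or.inl (by linarith)), sub_add_cancel]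
  field_simp

/-- Bounds for the average of a convex function on `[0, 1]` against the density `c * t ^ (c - 1)`,
whose barycenter is `l = c / (c + 1)`, in terms of the values at `0`, `l` and `1`. -/
theorem ConvexOn.integral_mul_const_mul_rpow_bounds {F : ℝ → ℝ} {l c : ℝ}
    (hF : ConvexOn ℝ (Set.Icc 0 1) F) (hcont : ContinuousOn F (Set.Icc 0 1))
    (hl0 : 0 < l) (hl1 : l < 1) (hc : 0 < c) (hlc : c / (c + 1) = l) :
    (1 - l ^ c) * ((1 - l) * F 0 + l * F 1 - F l) ≤
      (1 - l) * F 0 + l * F 1 - ∫ t in (0 : ℝ)..1, F t * (c * t ^ (c - 1)) ∧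
    (1 - l) * F 0 + l * F 1 - ∫ t in (0 : ℝ)..1, F t * (c * t ^ (c - 1)) ≤
      (1 + l ^ c) * ((1 - l) * F 0 + l * F 1 - F l) := by
  have h1l : 0 < 1 - l := sub_pos.2 hl1
  have m0 : (0 : ℝ) ∈ Set.Icc (0 : ℝ) 1 := by simp
  have m1 : (1 : ℝ) ∈ Set.Icc (0 : ℝ) 1 := by simp
  have ml : l ∈ Set.Icc (0 : ℝ) 1 := ⟨hl0.le, hl1.le⟩
  have i0 : IntervalIntegrable (fun t => F t * (c * t ^ (c - 1))) volume 0 l :=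
    intervalIntegrable_mul_const_mul_rpow hc (hcont.mono (Set.uIcc_subset_Icc m0 ml))
  have i1 : IntervalIntegrable (fun t => F t * (c * t ^ (c - 1))) volume l 1 :=
    intervalIntegrable_mul_const_mul_rpow hc (hcont.mono (Set.uIcc_subset_Icc ml m1))
  have iaff (p q x y : ℝ) :
      IntervalIntegrable (fun t => (p + q * t) * (c * t ^ (c - 1))) volume x y :=
    intervalIntegrable_mul_const_mul_rpow hc (by fun_prop)
  have hw {t : ℝ} (ht : 0 ≤ t) : 0 ≤ c * t ^ (c - 1) := by positivity
  -- The chords of `F` over `[0, l]` and `[l, 1]`, extended to the whole line.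
  obtain ⟨q₀, hq₀⟩ : ∃ q, q * l = F l - F 0 := ⟨(F l - F 0) / l, by field_simp⟩
  obtain ⟨q₁, hq₁⟩ : ∃ q, q * (1 - l) = F 1 - F l := ⟨(F 1 - F l) / (1 - l), by field_simp⟩
  have u0 := integral_mono_on hl0.le i0 (iaff (F 0) q₀ 0 l) fun t ht => by
    refine mul_le_mul_of_nonneg_right (le_of_mul_le_mul_left ?_ hl0) (hw ht.1)
    linear_combination hF.sub_mul_le_sub_mul_add_sub_mul m0 ml ht.1 ht.2 - t * hq₀
  have u1 := integral_mono_on hl1.le i1 (iaff (F 1 - q₁) q₁ l 1) fun t ht => by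
    refine mul_le_mul_of_nonneg_right (le_of_mul_le_mul_left ?_ h1l) (hw (hl0.le.trans ht.1))
    linear_combination hF.sub_mul_le_sub_mul_add_sub_mul ml m1 ht.1 ht.2 + (1 - t) * hq₁
  have v0 := integral_mono_on hl0.le (iaff (F 1 - q₁) q₁ 0 l) i0 fun t ht => by
    refine mul_le_mul_of_nonneg_right (le_of_mul_le_mul_left ?_ h1l) (hw ht.1)
    linear_combination hF.sub_mul_le_sub_mul_add_sub_mul ⟨ht.1, ht.2.trans hl1.le⟩ m1 ht.2 hl1.le
      - (1 - t) * hq₁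
  have v1 := integral_mono_on hl1.le (iaff (F 0) q₀ l 1) i1 fun t ht => by
    refine mul_le_mul_of_nonneg_right (le_of_mul_le_mul_left ?_ hl0) (hw (hl0.le.trans ht.1))
    linear_combination hF.sub_mul_le_sub_mul_add_sub_mul m0 ⟨hl0.le.trans ht.1, ht.2⟩ hl0.le ht.1
      + t * hq₀
  rw [integral_affine_mul_const_mul_rpow hc le_rfl hl0.le, hlc, Real.zero_rpow hc.ne',
    Real.zero_rpow (by positivity), Real.rpow_add_one hl0.ne'] at u0 v0
  rw [integral_affine_mul_const_mul_rpow hc hl0.le hl1.le, hlc, Real.one_rpow, Real.one_rpow,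
    Real.rpow_add_one hl0.ne'] at u1 v1
  rw [← integral_add_adjacent_intervals i0 i1]
  constructor
  · linear_combination u0 + u1 + l ^ c * l * hq₀ - (1 - l ^ c * (1 + l)) * hq₁
  · linear_combination v0 + v1 - (1 - l ^ c * l) * hq₀ + l ^ c * (1 + l) * hq₁

/-- Scalar corollary of Theorem 2.10 with `s = λ`. -/
theorem stmt_12 (l : ℝ) (hl : l ∈ Set.Ioo (0 : ℝ) 1)
    (I : Set ℝ) (hI : Convex ℝ I) (f : ℝ → ℝ) (hf : ConvexOn ℝ I f)
    (a b : ℝ) (ha : a ∈ I) (hb : b ∈ I) (hcont : ContinuousOn f (segment ℝ a b)) :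
    (1 - l ^ (l / (1 - l))) *
        ((1 - l) * f a + l * f b - f ((1 - l) * a + l * b)) ≤
      (1 - l) * f a + l * f b -
        (∫ t in (0 : ℝ)..1, f ((1 - t) * a + t * b) *
          (l / (1 - l) * t ^ ((2 * l - 1) / (1 - l)))) ∧
    (1 - l) * f a + l * f b -
        (∫ t in (0 : ℝ)..1, f ((1 - t) * a + t * b) *
          (l / (1 - l) * t ^ ((2 * l - 1) / (1 - l)))) ≤
      (1 + l ^ (l / (1 - l))) *
        ((1 - l) * f a + l * f b - f ((1 - l) * a + l * b)) := by
  obtain ⟨hl0, hl1⟩ := hl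
  have h1l : 0 < 1 - l := sub_pos.2 hl1
  have hexp : (2 * l - 1) / (1 - l) = l / (1 - l) - 1 := by field_simp; ring
  have hcomb {t : ℝ} (ht : t ∈ Set.Icc (0 : ℝ) 1) : (1 - t) * a + t * b ∈ segment ℝ a b :=
    ⟨1 - t, t, sub_nonneg.2 ht.2, ht.1, by ring, rfl⟩
  have hconv : ConvexOn ℝ (Set.Icc 0 1) fun t => f ((1 - t) * a + t * b) := by
    refine ⟨convex_Icc 0 1, fun x hx y hy p q hp hq hpq => ?_⟩
    have hsub := hI.segment_subset ha hb
    convert hf.2 (hsub (hcomb hx)) (hsub (hcomb hy)) hp hq hpq using 2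
    simp only [smul_eq_mul]
    linear_combination -a * hpq
  have hcontF : ContinuousOn (fun t => f ((1 - t) * a + t * b)) (Set.Icc 0 1) :=
    hcont.comp (by fun_prop) fun t ht => hcomb ht
  rw [hexp]
  simpa using hconv.integral_mul_const_mul_rpow_bounds hcontF hl0 hl1 (div_pos hl0 h1l)
    (by field_simp; ring)
end

section
/- Let λ ∈ (0,1), let I ⊆ ℝ be an open interval, f : ℝ → ℝ convex and differentiable on I, and a, b ∈ I. Then 0 ≤ ∫₀¹ f((1-t)a+tb) dη_λ(t) - f((1-λ)a+λb) ≤ (b-a)·∫₀¹ (t-λ)·f′((1-t)a+tb) dη_λ(t). -/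
/-- A function which is convex on `S` lies above its tangent lines. -/
lemma ConvexOn.add_deriv_mul_sub_le {S : Set ℝ} {f : ℝ → ℝ} {x y : ℝ} (hf : ConvexOn ℝ S f)
    (hx : x ∈ S) (hy : y ∈ S) (hd : DifferentiableAt ℝ f x) :
    f x + deriv f x * (y - x) ≤ f y := by
  rcases lt_trichotomy x y with h | rfl | h
  · have := hf.deriv_le_slope hx hy h hd
    rw [slope_def_field, le_div_iff₀ (sub_pos.2 h)] at this
    linarith
  · simp
  · have := hf.slope_le_deriv hy hx h hd
    rw [slope_def_field, div_le_iff₀ (sub_pos.2 h)] at this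
    linarith

/-- The density `c * t ^ (c - 1)` on `[0, 1]` has total mass one and mean `c / (c + 1)`. -/
lemma integral_affine_mul_rpow_density {c : ℝ} (hc : 0 < c) (K D : ℝ) :
    ∫ t in (0 : ℝ)..1, (K + D * (t - c / (c + 1))) * (c * t ^ (c - 1)) = K := by
  have h₀ : IntervalIntegrable (fun t : ℝ => t ^ (c - 1)) MeasureTheory.volume 0 1 :=
    intervalIntegral.intervalIntegrable_rpow' (by linarith)
  have h₁ : IntervalIntegrable (fun t : ℝ => t ^ c) MeasureTheory.volume 0 1 :=
    intervalIntegral.intervalIntegrable_rpow' (by linarith)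
  have hcongr : ∫ t in (0 : ℝ)..1, (K + D * (t - c / (c + 1))) * (c * t ^ (c - 1)) =
      ∫ t in (0 : ℝ)..1, ((K - D * (c / (c + 1))) * c * t ^ (c - 1) + D * c * t ^ c) := by
    refine intervalIntegral.integral_congr_ae (.of_forall fun t ht => ?_)
    rw [Set.uIoc_of_le zero_le_one] at ht
    have : t ^ c = t ^ (c - 1) * t := by
      rw [← Real.rpow_add_one ht.1.ne', sub_add_cancel]
    rw [this]
    ring
  rw [hcongr, intervalIntegral.integral_add (h₀.const_mul _) (h₁.const_mul _),
    intervalIntegral.integral_const_mul, intervalIntegral.integral_const_mul,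
    integral_rpow (.inl (by linarith)), integral_rpow (.inl (by linarith)), sub_add_cancel,
    Real.zero_rpow hc.ne', Real.zero_rpow (by linarith)]
  have : c + 1 ≠ 0 := by linarith
  simp only [Real.one_rpow]
  field_simp
  ring

/-- Scalar corollary of Theorem 2.12: for `f` convex and differentiable on an open
interval `I` containing `a, b`,
`0 ≤ ∫₀¹ f(a∇_t b) dη_λ(t) - f(a∇_λ b) ≤ (b-a) ∫₀¹ (t-λ) f′(a∇_t b) dη_λ(t)`. -/
theorem stmt_13 (l : ℝ) (hl : l ∈ Set.Ioo (0 : ℝ) 1)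
    (I : Set ℝ) (hI : Convex ℝ I) (hIopen : IsOpen I)
    (f : ℝ → ℝ) (hf : ConvexOn ℝ I f) (hdiff : ∀ x ∈ I, DifferentiableAt ℝ f x)
    (a b : ℝ) (ha : a ∈ I) (hb : b ∈ I) :
    0 ≤ (∫ t in (0 : ℝ)..1, f ((1 - t) * a + t * b) *
          (l / (1 - l) * t ^ ((2 * l - 1) / (1 - l)))) -
        f ((1 - l) * a + l * b) ∧
    (∫ t in (0 : ℝ)..1, f ((1 - t) * a + t * b) *
          (l / (1 - l) * t ^ ((2 * l - 1) / (1 - l)))) -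
        f ((1 - l) * a + l * b) ≤
      (b - a) * (∫ t in (0 : ℝ)..1, (t - l) * deriv f ((1 - t) * a + t * b) *
          (l / (1 - l) * t ^ ((2 * l - 1) / (1 - l)))) := by
  obtain ⟨hl0, hl1⟩ := hl
  have h1l : 0 < 1 - l := sub_pos.2 hl1
  have hexp : (2 * l - 1) / (1 - l) = l / (1 - l) - 1 := by
    field_simp
    ring
  have hmean : l / (1 - l) / (l / (1 - l) + 1) = l := by
    field_simp
    ring
  rw [hexp]
  set c := l / (1 - l)
  have hc : 0 < c := div_pos hl0 h1l
  have hmem : ∀ t ∈ Set.Icc (0 : ℝ) 1, (1 - t) * a + t * b ∈ I := fun t ht =>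
    hI ha hb (sub_nonneg.2 ht.2) ht.1 (by ring)
  have hm := hmem l ⟨hl0.le, hl1.le⟩
  set m := (1 - l) * a + l * b with hm_def
  have hw : IntervalIntegrable (fun t : ℝ => c * t ^ (c - 1)) MeasureTheory.volume 0 1 :=
    (intervalIntegral.intervalIntegrable_rpow' (by linarith)).const_mul c
  have hw0 : ∀ t ∈ Set.Icc (0 : ℝ) 1, 0 ≤ c * t ^ (c - 1) := fun t ht =>
    mul_nonneg hc.le (Real.rpow_nonneg ht.1 _)
  have haff (K D : ℝ) : ∫ t in (0 : ℝ)..1, (K + D * (t - l)) * (c * t ^ (c - 1)) = K := by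
    simpa only [hmean] using integral_affine_mul_rpow_density hc K D
  have hconst : ∫ t in (0 : ℝ)..1, f m * (c * t ^ (c - 1)) = f m := by
    simpa using haff (f m) 0
  have hint : IntervalIntegrable (fun t : ℝ => f ((1 - t) * a + t * b) * (c * t ^ (c - 1)))
      MeasureTheory.volume 0 1 := by
    refine hw.continuousOn_mul fun t ht => ContinuousAt.continuousWithinAt ?_
    rw [Set.uIcc_of_le zero_le_one] at ht
    exact ContinuousAt.comp' (f := fun t : ℝ => (1 - t) * a + t * b)
      (hdiff _ (hmem t ht)).continuousAt (by fun_prop)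
  have hint' : IntervalIntegrable (fun t : ℝ =>
      (t - l) * deriv f ((1 - t) * a + t * b) * (c * t ^ (c - 1))) MeasureTheory.volume 0 1 := by
    have hmono := hf.monotoneOn_deriv hdiff
    have hminmax : min a b ∈ I ∧ max a b ∈ I := by
      rcases le_total a b with h | h <;> simp [h, ha, hb]
    have hderiv : IntervalIntegrable (fun t : ℝ =>
        deriv f ((1 - t) * a + t * b) * (c * t ^ (c - 1))) MeasureTheory.volume 0 1 := by
      rw [intervalIntegrable_iff] at hw ⊢
      refine MeasureTheory.Integrable.bdd_mul
        (c := max |deriv f (min a b)| |deriv f (max a b)|) hw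
        ((measurable_deriv f).comp (by fun_prop)).aestronglyMeasurable ?_
      refine (MeasureTheory.ae_restrict_iff' measurableSet_uIoc).2 (.of_forall fun t ht => ?_)
      rw [Set.uIoc_of_le zero_le_one] at ht
      have ht' := Set.Ioc_subset_Icc_self ht
      have hlow : min a b ≤ (1 - t) * a + t * b := by
        nlinarith [min_le_left a b, min_le_right a b, ht'.1, ht'.2]
      have hupp : (1 - t) * a + t * b ≤ max a b := by
        nlinarith [le_max_left a b, le_max_right a b, ht'.1, ht'.2]
      exact abs_le_max_abs_abs (hmono hminmax.1 (hmem t ht') hlow)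
        (hmono (hmem t ht') hminmax.2 hupp)
    simpa only [mul_assoc] using hderiv.continuousOn_mul
      (g := fun t : ℝ => t - l) (by fun_prop)
  constructor
  · have hle := intervalIntegral.integral_mono_on zero_le_one
      (hw.continuousOn_mul (g := fun t : ℝ => f m + deriv f m * (b - a) * (t - l)) (by fun_prop))
      hint fun t ht => mul_le_mul_of_nonneg_right (by
        have h := hf.add_deriv_mul_sub_le hm (hmem t ht) (hdiff m hm)
        rw [show (1 - t) * a + t * b - m = (b - a) * (t - l) by rw [hm_def]; ring] at h
        linarith) (hw0 t ht)
    rw [haff] at hle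
    exact sub_nonneg.2 hle
  · have hle := intervalIntegral.integral_mono_on zero_le_one
      (hint.sub (hw.const_mul (f m))) (hint'.const_mul (b - a)) fun t ht => by
        have h := hf.add_deriv_mul_sub_le (hmem t ht) hm (hdiff _ (hmem t ht))
        rw [show m - ((1 - t) * a + t * b) = -((b - a) * (t - l)) by rw [hm_def]; ring] at h
        have h' : f ((1 - t) * a + t * b) - f m ≤
            (b - a) * ((t - l) * deriv f ((1 - t) * a + t * b)) := by linarith
        calc _ = (f ((1 - t) * a + t * b) - f m) * (c * t ^ (c - 1)) := by ring
          _ ≤ _ := mul_le_mul_of_nonneg_right h' (hw0 t ht)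
          _ = _ := by ring
    rwa [intervalIntegral.integral_sub hint (hw.const_mul (f m)), hconst,
      intervalIntegral.integral_const_mul] at hle
end

section
/- Let λ ∈ (0,1) and define f_λ : (0,∞) → ℝ by f_λ(x) = (∫₀¹ ((1-t)+tx)⁻¹ dη_λ(t))⁻¹. Then f_λ is monotone increasing on (0,∞), f_λ(1) = 1, and f_λ is differentiable at 1 with derivative f_λ′(1) = λ. -/
open MeasureTheory Set Filter Topology

lemma one_sub_add_mul_pos {t x : ℝ} (ht : t ∈ Icc (0 : ℝ) 1) (hx : 0 < x) :
    0 < (1 - t) + t * x := by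
  rcases ht.1.eq_or_lt with h | h
  · simp [← h]
  · have := mul_pos h hx
    linarith [ht.2]

lemma intervalIntegrable_inv_segment_mul {w : ℝ → ℝ} (hw : IntervalIntegrable w volume 0 1)
    {x : ℝ} (hx : 0 < x) :
    IntervalIntegrable (fun t => ((1 - t) + t * x)⁻¹ * w t) volume 0 1 := by
  refine hw.continuousOn_mul (ContinuousOn.inv₀ (by fun_prop) fun t ht => ?_)
  rw [uIcc_of_le zero_le_one] at ht
  exact (one_sub_add_mul_pos ht hx).ne'

lemma integral_inv_segment_mul_antitoneOn {w : ℝ → ℝ} (hw : IntervalIntegrable w volume 0 1)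
    (hw0 : ∀ t ∈ Icc (0 : ℝ) 1, 0 ≤ w t) :
    AntitoneOn (fun x : ℝ => ∫ t in (0 : ℝ)..1, ((1 - t) + t * x)⁻¹ * w t) (Ioi 0) := by
  intro x hx y hy hxy
  refine intervalIntegral.integral_mono_on zero_le_one
    (intervalIntegrable_inv_segment_mul hw hy) (intervalIntegrable_inv_segment_mul hw hx)
    fun t ht => ?_
  have := one_sub_add_mul_pos ht hx
  have := hw0 t ht
  have := ht.1
  gcongr

lemma integral_inv_segment_mul_pos {w : ℝ → ℝ} (hw : IntervalIntegrable w volume 0 1)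
    (hw0 : ∀ t ∈ Ioo (0 : ℝ) 1, 0 < w t) {x : ℝ} (hx : 0 < x) :
    0 < ∫ t in (0 : ℝ)..1, ((1 - t) + t * x)⁻¹ * w t :=
  intervalIntegral.intervalIntegral_pos_of_pos_on (intervalIntegrable_inv_segment_mul hw hx)
    (fun t ht => mul_pos (inv_pos.2 (one_sub_add_mul_pos (Ioo_subset_Icc_self ht) hx)) (hw0 t ht))
    one_pos

lemma hasDerivAt_integral_inv_segment_mul {w : ℝ → ℝ} (hw : IntervalIntegrable w volume 0 1) :
    HasDerivAt (fun x : ℝ => ∫ t in (0 : ℝ)..1, ((1 - t) + t * x)⁻¹ * w t)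
      (-∫ t in (0 : ℝ)..1, t * w t) 1 := by
  have hs : Ioi (1 / 2 : ℝ) ∈ 𝓝 (1 : ℝ) := Ioi_mem_nhds (by norm_num)
  have hb : ∀ t ∈ uIoc (0 : ℝ) 1, ∀ x ∈ Ioi (1 / 2 : ℝ), 1 / 2 ≤ (1 - t) + t * x := by
    intro t ht x hx
    rw [uIoc_of_le zero_le_one] at ht
    have hx : 1 / 2 < x := hx
    nlinarith [ht.1, ht.2]
  have key := (intervalIntegral.hasDerivAt_integral_of_dominated_loc_of_deriv_le (μ := volume)
    (F := fun x t => ((1 - t) + t * x)⁻¹ * w t)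
    (F' := fun x t => -t / ((1 - t) + t * x) ^ 2 * w t)
    (bound := fun t => 4 * ‖w t‖) hs ?_ (intervalIntegrable_inv_segment_mul hw one_pos)
    ?_ ?_ (hw.norm.const_mul 4) ?_).2
  · rw [← intervalIntegral.integral_neg]
    simpa using key
  · filter_upwards [hs] with x hx
    have hx : 1 / 2 < x := hx
    exact (intervalIntegrable_inv_segment_mul hw (by linarith)).def'.aestronglyMeasurable
  · exact AEStronglyMeasurable.mul
      (Measurable.aestronglyMeasurable (by fun_prop)) hw.def'.aestronglyMeasurable
  · refine ae_of_all _ fun t ht x hx => ?_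
    have h := hb t ht x hx
    rw [uIoc_of_le zero_le_one] at ht
    rw [norm_mul]
    gcongr
    rw [norm_div, norm_neg, Real.norm_of_nonneg ht.1.le, Real.norm_of_nonneg (by positivity),
      div_le_iff₀ (by positivity)]
    nlinarith [ht.2]
  · refine ae_of_all _ fun t ht x hx => ?_
    have h := hb t ht x hx
    have h1 : HasDerivAt (fun x : ℝ => (1 - t) + t * x) t x := by
      simpa using ((hasDerivAt_id x).const_mul t).const_add (1 - t)
    exact (h1.fun_inv (by linarith)).mul_const _

/-- Properties of the representing function `f_λ(x) = (∫₀¹ ((1-t)+tx)⁻¹ dη_λ(t))⁻¹`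
of the weighted logarithmic mean `L_λ`: monotone on `(0,∞)`, `f_λ(1) = 1` and
`f_λ′(1) = λ`. -/
theorem stmt_14 (l : ℝ) (hl : l ∈ Set.Ioo (0 : ℝ) 1) :
    MonotoneOn (fun x : ℝ =>
        (∫ t in (0 : ℝ)..1, ((1 - t) + t * x)⁻¹ *
          (l / (1 - l) * t ^ ((2 * l - 1) / (1 - l))))⁻¹) (Set.Ioi 0) ∧
    (∫ t in (0 : ℝ)..1, ((1 - t) + t * (1 : ℝ))⁻¹ *
        (l / (1 - l) * t ^ ((2 * l - 1) / (1 - l))))⁻¹ = 1 ∧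
    HasDerivAt (fun x : ℝ =>
        (∫ t in (0 : ℝ)..1, ((1 - t) + t * x)⁻¹ *
          (l / (1 - l) * t ^ ((2 * l - 1) / (1 - l))))⁻¹) l 1 := by
  obtain ⟨h0, h1⟩ := hl
  have h2 : 0 < 1 - l := by linarith
  have h3 : l ≠ 0 := h0.ne'
  have h4 : 1 - l ≠ 0 := h2.ne'
  set p := (2 * l - 1) / (1 - l) with hp
  have hp1 : p + 1 = l / (1 - l) := by rw [hp]; field_simp; ring
  have hp2 : p + 1 + 1 = 1 / (1 - l) := by rw [hp1]; field_simp; ring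
  have hpos : 0 < l / (1 - l) := by positivity
  have hp' : -1 < p := by linarith
  have hw : IntervalIntegrable (fun t : ℝ => l / (1 - l) * t ^ p) volume 0 1 :=
    (intervalIntegral.intervalIntegrable_rpow' hp').const_mul _
  have hw0 : ∀ t ∈ Ioo (0 : ℝ) 1, 0 < l / (1 - l) * t ^ p := fun t ht =>
    mul_pos hpos (Real.rpow_pos_of_pos ht.1 p)
  have hone : ∫ t in (0 : ℝ)..1, ((1 - t) + t * (1 : ℝ))⁻¹ * (l / (1 - l) * t ^ p) = 1 := by
    simp only [mul_one, sub_add_cancel, inv_one, one_mul]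
    rw [intervalIntegral.integral_const_mul, integral_rpow (Or.inl hp'), hp1,
      Real.one_rpow, Real.zero_rpow hpos.ne']
    field_simp
    ring
  have hmean : ∫ t in (0 : ℝ)..1, t * (l / (1 - l) * t ^ p) = l := by
    have : ∀ t ∈ uIcc (0 : ℝ) 1, t * (l / (1 - l) * t ^ p) = l / (1 - l) * t ^ (p + 1) := by
      intro t ht
      rw [uIcc_of_le zero_le_one] at ht
      rw [Real.rpow_add_one' ht.1 (by linarith)]
      ring
    rw [intervalIntegral.integral_congr this, intervalIntegral.integral_const_mul,
      integral_rpow (Or.inl (by linarith)), hp2, Real.one_rpow, Real.zero_rpow (by positivity)]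
    field_simp
    ring
  refine ⟨fun x hx y hy hxy => ?_, by rw [hone, inv_one], ?_⟩
  · exact inv_anti₀ (integral_inv_segment_mul_pos hw hw0 hy)
      (integral_inv_segment_mul_antitoneOn hw
        (fun t ht => mul_nonneg hpos.le (Real.rpow_nonneg ht.1 p)) hx hy hxy)
  · have h := (hasDerivAt_integral_inv_segment_mul hw).fun_inv (by rw [hone]; exact one_ne_zero)
    rw [hone, hmean] at h
    simpa using h
end

section
/- Let λ ∈ (0,1) and define g_λ : (0,∞) → ℝ by g_λ(x) = ∫₀¹ x^t dη_λ(t). Then g_λ is monotone increasing on (0,∞), g_λ(1) = 1, and g_λ is differentiable at 1 with derivative g_λ′(1) = λ. -/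
open MeasureTheory Set

theorem intervalIntegrable_rpow_mul {w : ℝ → ℝ} (hw : IntervalIntegrable w volume 0 1)
    {x : ℝ} (hx : 0 < x) : IntervalIntegrable (fun t => x ^ t * w t) volume 0 1 :=
  hw.continuousOn_mul (Real.continuous_const_rpow hx.ne').continuousOn

theorem monotoneOn_integral_rpow_mul {w : ℝ → ℝ} (hw : IntervalIntegrable w volume 0 1)
    (hw0 : ∀ t ∈ Icc (0 : ℝ) 1, 0 ≤ w t) :
    MonotoneOn (fun x : ℝ => ∫ t in (0 : ℝ)..1, x ^ t * w t) (Ioi 0) := by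
  intro x hx y hy hxy
  refine intervalIntegral.integral_mono_on zero_le_one (intervalIntegrable_rpow_mul hw hx)
    (intervalIntegrable_rpow_mul hw hy) fun t ht => ?_
  exact mul_le_mul_of_nonneg_right (Real.rpow_le_rpow (le_of_lt hx) hxy ht.1) (hw0 t ht)

theorem hasDerivAt_integral_rpow_mul_one {w : ℝ → ℝ} (hw : IntervalIntegrable w volume 0 1) :
    HasDerivAt (fun x : ℝ => ∫ t in (0 : ℝ)..1, x ^ t * w t) (∫ t in (0 : ℝ)..1, t * w t) 1 := by
  have hpos : ∀ x ∈ Ioi (1 / 2 : ℝ), 0 < x := fun x hx => lt_trans (by norm_num) (mem_Ioi.1 hx)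
  have hmeas : AEStronglyMeasurable (fun t : ℝ => t * (1 : ℝ) ^ (t - 1) * w t)
      (volume.restrict (uIoc 0 1)) := by
    simpa using (hw.continuousOn_mul continuousOn_id).def'.aestronglyMeasurable
  have key := (intervalIntegral.hasDerivAt_integral_of_dominated_loc_of_deriv_le
    (μ := volume) (F := fun x t => x ^ t * w t) (F' := fun x t => t * x ^ (t - 1) * w t)
    (bound := fun t => 2 * ‖w t‖) (Ioi_mem_nhds (by norm_num : (1 / 2 : ℝ) < 1))
    (by
      filter_upwards [Ioi_mem_nhds (by norm_num : (0 : ℝ) < 1)] with x hx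
      exact (intervalIntegrable_rpow_mul hw hx).def'.aestronglyMeasurable)
    (intervalIntegrable_rpow_mul hw one_pos) hmeas
    (by
      refine Filter.Eventually.of_forall fun t ht x hx => ?_
      rw [uIoc_of_le zero_le_one] at ht
      have hx0 := hpos x hx
      have hle : x ^ (t - 1) ≤ 2 := calc
        x ^ (t - 1) ≤ (1 / 2 : ℝ) ^ (t - 1) :=
          Real.rpow_le_rpow_of_nonpos (by norm_num) (le_of_lt hx) (by linarith [ht.2])
        _ ≤ (1 / 2 : ℝ) ^ (-1 : ℝ) :=
          Real.rpow_le_rpow_of_exponent_ge (by norm_num) (by norm_num) (by linarith [ht.1])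
        _ = 2 := by rw [Real.rpow_neg_one]; norm_num
      have hnn : 0 ≤ x ^ (t - 1) := Real.rpow_nonneg hx0.le _
      rw [norm_mul, Real.norm_of_nonneg (mul_nonneg ht.1.le hnn)]
      gcongr
      nlinarith [ht.1, ht.2])
    (hw.norm.const_mul 2)
    (by
      refine Filter.Eventually.of_forall fun t _ x hx => ?_
      exact (Real.hasDerivAt_rpow_const (Or.inl (hpos x hx).ne')).mul_const (w t))).2
  simpa using key

/-- Properties of the representing function `g_λ(x) = ∫₀¹ x^t dη_λ(t)` of the
weighted logarithmic mean `𝕃_λ`: monotone on `(0,∞)`, `g_λ(1) = 1` and `g_λ′(1) = λ`. -/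
theorem stmt_15 (l : ℝ) (hl : l ∈ Set.Ioo (0 : ℝ) 1) :
    MonotoneOn (fun x : ℝ =>
        ∫ t in (0 : ℝ)..1, x ^ t * (l / (1 - l) * t ^ ((2 * l - 1) / (1 - l))))
      (Set.Ioi 0) ∧
    (∫ t in (0 : ℝ)..1, (1 : ℝ) ^ t * (l / (1 - l) * t ^ ((2 * l - 1) / (1 - l)))) = 1 ∧
    HasDerivAt (fun x : ℝ =>
        ∫ t in (0 : ℝ)..1, x ^ t * (l / (1 - l) * t ^ ((2 * l - 1) / (1 - l)))) l 1 := by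
  obtain ⟨h0, h1⟩ := hl
  have h1' : 0 < 1 - l := sub_pos.2 h1
  have hp1 : (2 * l - 1) / (1 - l) + 1 = l / (1 - l) := by field_simp; ring
  have hp2 : (2 * l - 1) / (1 - l) + 1 + 1 = 1 / (1 - l) := by field_simp; ring
  have hc : 0 < l / (1 - l) := div_pos h0 h1'
  generalize (2 * l - 1) / (1 - l) = p at *
  have hp : -1 < p := by linarith
  have hw : IntervalIntegrable (fun t : ℝ => l / (1 - l) * t ^ p) volume 0 1 :=
    (intervalIntegral.intervalIntegrable_rpow' hp).const_mul _
  refine ⟨monotoneOn_integral_rpow_mul hw fun t ht =>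
    mul_nonneg hc.le (Real.rpow_nonneg ht.1 _), ?_, ?_⟩
  · simp only [Real.one_rpow, one_mul, intervalIntegral.integral_const_mul]
    rw [integral_rpow (Or.inl hp), hp1, Real.one_rpow, Real.zero_rpow hc.ne', sub_zero]
    field_simp
  · convert hasDerivAt_integral_rpow_mul_one hw using 1
    have hcongr : ∫ t in (0 : ℝ)..1, t * (l / (1 - l) * t ^ p) =
        ∫ t in (0 : ℝ)..1, l / (1 - l) * t ^ (p + 1) := by
      refine intervalIntegral.integral_congr fun t ht => ?_
      rw [uIcc_of_le zero_le_one] at ht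
      rw [Real.rpow_add_one' ht.1 (by linarith)]
      ring
    rw [hcongr, intervalIntegral.integral_const_mul, integral_rpow (Or.inl (by linarith)), hp2,
      Real.one_rpow, Real.zero_rpow (one_div_pos.2 h1').ne', sub_zero]
    field_simp
end

section
/- Let s, λ ∈ (0,1) and x ∈ (0,∞). Set α(s,λ) = ((1-λ)/(1-s))·(1 - s^(λ/(1-λ))) and μ(s,λ) = (1-λ)/(1-s) + λ/s - α(s,λ). Then α(s,λ)·((1-s) + sx - x^s) ≤ (1-λ) + λx - ∫₀¹ x^t dη_λ(t) ≤ μ(s,λ)·((1-s) + sx - x^s). -/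
open MeasureTheory intervalIntegral in
theorem intervalIntegrable_const_mul_rpow_sub_one {c : ℝ} (hc : 0 < c) (a b : ℝ) :
    IntervalIntegrable (fun t : ℝ => c * t ^ (c - 1)) volume a b :=
  (intervalIntegrable_rpow' (by linarith)).const_mul c

theorem integral_const_mul_rpow_sub_one {c : ℝ} (hc : 0 < c) (a b : ℝ) :
    ∫ t in a..b, c * t ^ (c - 1) = b ^ c - a ^ c := by
  rw [intervalIntegral.integral_const_mul, integral_rpow (Or.inl (by linarith))]
  simp only [sub_add_cancel]
  field_simp

theorem integral_id_mul_rpow_sub_one {c a b : ℝ} (hc : 0 < c) (ha : 0 ≤ a) (hb : 0 ≤ b) :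
    ∫ t in a..b, t * (c * t ^ (c - 1)) = c / (c + 1) * (b ^ (c + 1) - a ^ (c + 1)) := by
  have h : Set.EqOn (fun t : ℝ => t * (c * t ^ (c - 1))) (fun t => c * t ^ c)
      (Set.uIcc a b) := by
    intro t ht
    have ht0 : 0 ≤ t := (le_min ha hb).trans ht.1
    have := Real.rpow_add_one' ht0 (y := c - 1) (by simpa using hc.ne')
    rw [sub_add_cancel] at this
    simp only [this]
    ring
  rw [intervalIntegral.integral_congr h, intervalIntegral.integral_const_mul,
    integral_rpow (Or.inl (by linarith))]
  ring

theorem integral_affine_mul_rpow_sub_one {c a b : ℝ} (hc : 0 < c) (ha : 0 ≤ a) (hb : 0 ≤ b)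
    (p q : ℝ) :
    ∫ t in a..b, (p + q * t) * (c * t ^ (c - 1)) =
      p * (b ^ c - a ^ c) + q * (c / (c + 1) * (b ^ (c + 1) - a ^ (c + 1))) := by
  have hw := intervalIntegrable_const_mul_rpow_sub_one hc a b
  have hid := hw.continuousOn_mul continuousOn_id
  simp only [id] at hid
  simp only [add_mul, mul_assoc q]
  rw [intervalIntegral.integral_add (hw.const_mul p) (hid.const_mul q),
    intervalIntegral.integral_const_mul p, intervalIntegral.integral_const_mul q,
    integral_const_mul_rpow_sub_one hc, integral_id_mul_rpow_sub_one hc ha hb]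

/-- The integral of the tent function with peak value `1` at `s`. -/
theorem integral_tent_mul_rpow_sub_one {c s : ℝ} (hc : 0 < c) (hs : s ∈ Set.Ioo (0 : ℝ) 1) :
    ∫ t in (0 : ℝ)..1, min (t / s) ((1 - t) / (1 - s)) * (c * t ^ (c - 1)) =
      1 / (c + 1) / (1 - s) * (1 - s ^ c) := by
  obtain ⟨h0, h1⟩ := hs
  have h1' : 0 < 1 - s := sub_pos.2 h1
  have hm : Continuous fun t : ℝ => min (t / s) ((1 - t) / (1 - s)) := by fun_prop
  have hint : ∀ a b : ℝ, IntervalIntegrable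
      (fun t : ℝ => min (t / s) ((1 - t) / (1 - s)) * (c * t ^ (c - 1)))
      MeasureTheory.volume a b := fun a b =>
    (intervalIntegrable_const_mul_rpow_sub_one hc a b).continuousOn_mul hm.continuousOn
  have hleft : Set.EqOn (fun t : ℝ => min (t / s) ((1 - t) / (1 - s)) * (c * t ^ (c - 1)))
      (fun t => (0 + 1 / s * t) * (c * t ^ (c - 1))) (Set.uIcc 0 s) := by
    intro t ht
    rw [Set.uIcc_of_le h0.le] at ht
    have : t / s ≤ (1 - t) / (1 - s) := by
      rw [div_le_div_iff₀ h0 h1']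
      linarith [ht.2]
    simp only [min_eq_left this]
    ring
  have hright : Set.EqOn (fun t : ℝ => min (t / s) ((1 - t) / (1 - s)) * (c * t ^ (c - 1)))
      (fun t => (1 / (1 - s) + -1 / (1 - s) * t) * (c * t ^ (c - 1))) (Set.uIcc s 1) := by
    intro t ht
    rw [Set.uIcc_of_le h1.le] at ht
    have : (1 - t) / (1 - s) ≤ t / s := by
      rw [div_le_div_iff₀ h1' h0]
      linarith [ht.1]
    simp only [min_eq_right this]
    ring
  rw [← intervalIntegral.integral_add_adjacent_intervals (hint 0 s) (hint s 1),
    intervalIntegral.integral_congr hleft, intervalIntegral.integral_congr hright,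
    integral_affine_mul_rpow_sub_one hc le_rfl h0.le,
    integral_affine_mul_rpow_sub_one hc h0.le zero_le_one,
    Real.zero_rpow hc.ne', Real.zero_rpow (by positivity : c + 1 ≠ 0), Real.one_rpow,
    Real.one_rpow, Real.rpow_add_one h0.ne']
  field_simp
  ring

/-- A concave function vanishing at the endpoints of `[0, 1]` lies above the tent through its
graph at any interior point. -/
theorem ConcaveOn.mul_min_le {D : ℝ → ℝ} (hD : ConcaveOn ℝ (Set.Icc 0 1) D) (hD0 : D 0 = 0)
    (hD1 : D 1 = 0) {s t : ℝ} (hs : s ∈ Set.Ioo (0 : ℝ) 1) (ht : t ∈ Set.Icc (0 : ℝ) 1) :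
    D s * min (t / s) ((1 - t) / (1 - s)) ≤ D t := by
  obtain ⟨h0, h1⟩ := hs
  have h1' : 0 < 1 - s := sub_pos.2 h1
  have hsm : s ∈ Set.Icc (0 : ℝ) 1 := ⟨h0.le, h1.le⟩
  have hDs : 0 ≤ D s := by
    have := hD.2 (Set.left_mem_Icc.2 zero_le_one) (Set.right_mem_Icc.2 zero_le_one) h1'.le h0.le
      (by ring)
    simpa [hD0, hD1] using this
  rcases le_total t s with hts | hst
  · have := hD.2 (Set.left_mem_Icc.2 zero_le_one) hsm
      (sub_nonneg.2 ((div_le_one h0).2 hts)) (div_nonneg ht.1 h0.le) (by ring)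
    simp only [smul_eq_mul, hD0, mul_zero, zero_add, div_mul_cancel₀ _ h0.ne'] at this
    calc _ ≤ D s * (t / s) := mul_le_mul_of_nonneg_left (min_le_left _ _) hDs
      _ ≤ D t := by linarith
  · have h : (1 - t) / (1 - s) ≤ 1 := (div_le_one h1').2 (by linarith)
    have := hD.2 (Set.right_mem_Icc.2 zero_le_one) hsm
      (sub_nonneg.2 h) (div_nonneg (sub_nonneg.2 ht.2) h1'.le) (by ring)
    have e : (1 - (1 - t) / (1 - s)) * 1 + (1 - t) / (1 - s) * s = t := by
      field_simp
      ring
    simp only [smul_eq_mul, hD1, mul_zero, zero_add, e] at this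
    calc _ ≤ D s * ((1 - t) / (1 - s)) := mul_le_mul_of_nonneg_left (min_le_right _ _) hDs
      _ ≤ D t := by linarith

/-- A concave function vanishing at the endpoints of `[0, 1]` lies below the extended chords
through `(0, 0)` and `(1, 0)` and its graph at any interior point. -/
theorem ConcaveOn.le_mul_max {D : ℝ → ℝ} (hD : ConcaveOn ℝ (Set.Icc 0 1) D) (hD0 : D 0 = 0)
    (hD1 : D 1 = 0) {s t : ℝ} (hs : s ∈ Set.Ioo (0 : ℝ) 1) (ht : t ∈ Set.Icc (0 : ℝ) 1) :
    D t ≤ D s * max (t / s) ((1 - t) / (1 - s)) := by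
  obtain ⟨h0, h1⟩ := hs
  have h1' : 0 < 1 - s := sub_pos.2 h1
  have hDs : 0 ≤ D s := by
    have := hD.2 (Set.left_mem_Icc.2 zero_le_one) (Set.right_mem_Icc.2 zero_le_one) h1'.le h0.le
      (by ring)
    simpa [hD0, hD1] using this
  rcases ht.1.eq_or_lt with rfl | ht0
  · rw [hD0]
    exact mul_nonneg hDs (le_max_of_le_left (by simp))
  rcases ht.2.eq_or_lt with rfl | ht1
  · rw [hD1]
    exact mul_nonneg hDs (le_max_of_le_right (by simp))
  have ht1' : 0 < 1 - t := sub_pos.2 ht1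
  have key := hD.mul_min_le hD0 hD1 ⟨ht0, ht1⟩ (t := s) ⟨h0.le, h1.le⟩
  rcases le_total (s / t) ((1 - s) / (1 - t)) with h | h
  · rw [min_eq_left h, ← mul_div_assoc, div_le_iff₀ ht0] at key
    calc D t ≤ D s * (t / s) := by rwa [← mul_div_assoc, le_div_iff₀ h0]
      _ ≤ _ := mul_le_mul_of_nonneg_left (le_max_left _ _) hDs
  · rw [min_eq_right h, ← mul_div_assoc, div_le_iff₀ ht1'] at key
    calc D t ≤ D s * ((1 - t) / (1 - s)) := by rwa [← mul_div_assoc, le_div_iff₀ h1']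
      _ ≤ _ := mul_le_mul_of_nonneg_left (le_max_right _ _) hDs

/-- Refined weighted Hermite–Hadamard inequality for the probability measure with density
`c * t ^ (c - 1)` on `[0, 1]`. -/
theorem ConcaveOn.integral_mul_rpow_sub_one_bounds {D : ℝ → ℝ}
    (hD : ConcaveOn ℝ (Set.Icc 0 1) D) (hcont : Continuous D) (hD0 : D 0 = 0) (hD1 : D 1 = 0)
    {c s : ℝ} (hc : 0 < c) (hs : s ∈ Set.Ioo (0 : ℝ) 1) :
    1 / (c + 1) / (1 - s) * (1 - s ^ c) * D s ≤ ∫ t in (0 : ℝ)..1, D t * (c * t ^ (c - 1)) ∧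
    ∫ t in (0 : ℝ)..1, D t * (c * t ^ (c - 1)) ≤
      (1 / (c + 1) / (1 - s) + c / (c + 1) / s - 1 / (c + 1) / (1 - s) * (1 - s ^ c)) * D s := by
  have hint : ∀ g : ℝ → ℝ, Continuous g → IntervalIntegrable
      (fun t : ℝ => g t * (c * t ^ (c - 1))) MeasureTheory.volume 0 1 := fun g hg =>
    (intervalIntegrable_const_mul_rpow_sub_one hc 0 1).continuousOn_mul hg.continuousOn
  have hw : ∀ t ∈ Set.Icc (0 : ℝ) 1, 0 ≤ c * t ^ (c - 1) := fun t ht =>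
    mul_nonneg hc.le (Real.rpow_nonneg ht.1 _)
  have htent := integral_tent_mul_rpow_sub_one hc hs
  have hmin : Continuous fun t : ℝ => min (t / s) ((1 - t) / (1 - s)) := by fun_prop
  have hmax : Continuous fun t : ℝ => max (t / s) ((1 - t) / (1 - s)) := by fun_prop
  constructor
  · rw [← htent, mul_comm, ← intervalIntegral.integral_const_mul]
    refine intervalIntegral.integral_mono_on zero_le_one ((hint _ hmin).const_mul _)
      (hint _ hcont) fun t ht => ?_
    rw [← mul_assoc]
    exact mul_le_mul_of_nonneg_right (hD.mul_min_le hD0 hD1 hs ht) (hw t ht)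
  · have hmax_int : ∫ t in (0 : ℝ)..1, max (t / s) ((1 - t) / (1 - s)) * (c * t ^ (c - 1)) =
        1 / (c + 1) / (1 - s) + c / (c + 1) / s - 1 / (c + 1) / (1 - s) * (1 - s ^ c) := by
      have h : (fun t : ℝ => max (t / s) ((1 - t) / (1 - s)) * (c * t ^ (c - 1))) = fun t =>
          (1 / (1 - s) + (1 / s - 1 / (1 - s)) * t) * (c * t ^ (c - 1)) -
            min (t / s) ((1 - t) / (1 - s)) * (c * t ^ (c - 1)) := by
        funext t
        rw [eq_sub_of_add_eq' (min_add_max (t / s) ((1 - t) / (1 - s)))]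
        ring
      rw [h, intervalIntegral.integral_sub (hint _ (by fun_prop)) (hint _ hmin), htent,
        integral_affine_mul_rpow_sub_one hc le_rfl zero_le_one, Real.zero_rpow hc.ne',
        Real.zero_rpow (by positivity : c + 1 ≠ 0), Real.one_rpow, Real.one_rpow]
      have : c + 1 ≠ 0 := by positivity
      have : 1 - s ≠ 0 := (sub_pos.2 hs.2).ne'
      have : s ≠ 0 := hs.1.ne'
      field_simp
      ring
    rw [← hmax_int, mul_comm _ (D s), ← intervalIntegral.integral_const_mul]
    refine intervalIntegral.integral_mono_on zero_le_one (hint _ hcont)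
      ((hint _ hmax).const_mul _) fun t ht => ?_
    rw [← mul_assoc (D s)]
    exact mul_le_mul_of_nonneg_right (hD.le_mul_max hD0 hD1 hs ht) (hw t ht)

theorem concaveOn_affine_sub_rpow {x : ℝ} (hx : 0 < x) :
    ConcaveOn ℝ (Set.Icc 0 1) fun t : ℝ => (1 - t) + t * x - x ^ t := by
  have hconv : ConvexOn ℝ Set.univ fun t : ℝ => x ^ t := by
    have := convexOn_exp.comp_linearMap (LinearMap.mul ℝ ℝ (Real.log x))
    refine this.congr fun t _ => ?_
    simp [Real.rpow_def_of_pos hx]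
  refine ⟨convex_Icc 0 1, fun a _ b _ p q hp hq hpq => ?_⟩
  have := hconv.2 (Set.mem_univ a) (Set.mem_univ b) hp hq hpq
  simp only [smul_eq_mul] at this ⊢
  obtain rfl : q = 1 - p := by linarith
  linarith

/-- Scalar form of Theorem 3.6 for `𝕃_λ`:
`α(s,λ)((1-s)+sx-x^s) ≤ (1-λ)+λx - ∫₀¹ x^t dη_λ(t) ≤ μ(s,λ)((1-s)+sx-x^s)`,
with `α(s,λ) = ((1-λ)/(1-s))(1-s^(λ/(1-λ)))`, `μ(s,λ) = (1-λ)/(1-s)+λ/s-α(s,λ)`. -/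
theorem stmt_18 (s l : ℝ) (hs : s ∈ Set.Ioo (0 : ℝ) 1) (hl : l ∈ Set.Ioo (0 : ℝ) 1)
    (x : ℝ) (hx : 0 < x) :
    (1 - l) / (1 - s) * (1 - s ^ (l / (1 - l))) * ((1 - s) + s * x - x ^ s) ≤
      (1 - l) + l * x -
        (∫ t in (0 : ℝ)..1, x ^ t * (l / (1 - l) * t ^ ((2 * l - 1) / (1 - l)))) ∧
    (1 - l) + l * x -
        (∫ t in (0 : ℝ)..1, x ^ t * (l / (1 - l) * t ^ ((2 * l - 1) / (1 - l)))) ≤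
      ((1 - l) / (1 - s) + l / s - (1 - l) / (1 - s) * (1 - s ^ (l / (1 - l)))) *
        ((1 - s) + s * x - x ^ s) := by
  have h1l : 1 - l ≠ 0 := (sub_pos.2 hl.2).ne'
  have hc : 0 < l / (1 - l) := div_pos hl.1 (sub_pos.2 hl.2)
  have hexp : (2 * l - 1) / (1 - l) = l / (1 - l) - 1 := by
    field_simp
    ring
  have hc1 : 1 / (l / (1 - l) + 1) = 1 - l := by
    field_simp
    ring
  have hc2 : l / (1 - l) / (l / (1 - l) + 1) = l := by
    field_simp
    ring
  have hrpow : Continuous fun t : ℝ => x ^ t := Real.continuous_const_rpow hx.ne'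
  have key := (concaveOn_affine_sub_rpow hx).integral_mul_rpow_sub_one_bounds (by fun_prop)
    (by simp) (by simp) hc hs
  rw [hexp]
  set c := l / (1 - l)
  have hw := intervalIntegrable_const_mul_rpow_sub_one hc 0 1
  have hI : ∫ t in (0 : ℝ)..1, ((1 - t) + t * x - x ^ t) * (c * t ^ (c - 1)) =
      (1 - l) + l * x - ∫ t in (0 : ℝ)..1, x ^ t * (c * t ^ (c - 1)) := by
    have h : (fun t : ℝ => ((1 - t) + t * x - x ^ t) * (c * t ^ (c - 1))) = fun t =>
        (1 + (x - 1) * t) * (c * t ^ (c - 1)) - x ^ t * (c * t ^ (c - 1)) := by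
      funext t
      ring
    rw [h, intervalIntegral.integral_sub
      (hw.continuousOn_mul (by fun_prop : Continuous fun t : ℝ => 1 + (x - 1) * t).continuousOn)
      (hw.continuousOn_mul hrpow.continuousOn),
      integral_affine_mul_rpow_sub_one hc le_rfl zero_le_one, Real.zero_rpow hc.ne',
      Real.zero_rpow (by positivity : c + 1 ≠ 0), Real.one_rpow, Real.one_rpow, hc2]
    ring
  rwa [hI, hc1, hc2] at key
end

section
/- Let λ ∈ (0,1), s ∈ [0,1], and x ∈ (0,∞). Then (1-λ) + λ·x^s ≤ ∫₀¹ ((1-t)+tx)^s dη_λ(t) ≤ ((1-λ)+λx)^s. -/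
theorem intervalIntegrable_beta_density {l : ℝ} (hl : l ∈ Set.Ioo (0 : ℝ) 1) :
    IntervalIntegrable (fun t : ℝ => l / (1 - l) * t ^ ((2 * l - 1) / (1 - l)))
      MeasureTheory.volume 0 1 := by
  have h1 : 0 < 1 - l := sub_pos.2 hl.2
  refine (intervalIntegral.intervalIntegrable_rpow' ?_).const_mul _
  rw [lt_div_iff₀ h1]
  linarith [hl.1]

/-- The density `t ↦ λ/(1-λ) · t^((2λ-1)/(1-λ))` has total mass `1` and mean `λ`. -/
theorem integral_affine_mul_beta_density {l : ℝ} (hl : l ∈ Set.Ioo (0 : ℝ) 1) (p q : ℝ) :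
    ∫ t in (0 : ℝ)..1, (p + q * t) * (l / (1 - l) * t ^ ((2 * l - 1) / (1 - l))) =
      p + q * l := by
  have h0 : 0 < l := hl.1
  have h1 : 0 < 1 - l := sub_pos.2 hl.2
  have ha : -1 < (2 * l - 1) / (1 - l) := by
    rw [lt_div_iff₀ h1]
    linarith
  have ha1 : (2 * l - 1) / (1 - l) + 1 = l / (1 - l) := by field_simp; ring
  have ha2 : (2 * l - 1) / (1 - l) + 1 + 1 = 1 / (1 - l) := by field_simp; ring
  have hcongr : ∫ t in (0 : ℝ)..1, (p + q * t) * (l / (1 - l) * t ^ ((2 * l - 1) / (1 - l))) =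
      ∫ t in (0 : ℝ)..1, (p * (l / (1 - l)) * t ^ ((2 * l - 1) / (1 - l)) +
        q * (l / (1 - l)) * t ^ ((2 * l - 1) / (1 - l) + 1)) := by
    refine intervalIntegral.integral_congr_ae (Filter.Eventually.of_forall fun t ht => ?_)
    rw [Set.uIoc_of_le zero_le_one] at ht
    rw [Real.rpow_add_one ht.1.ne']
    ring
  rw [hcongr, intervalIntegral.integral_add
    ((intervalIntegral.intervalIntegrable_rpow' ha).const_mul _)
    ((intervalIntegral.intervalIntegrable_rpow' (by linarith)).const_mul _),
    intervalIntegral.integral_const_mul, intervalIntegral.integral_const_mul,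
    integral_rpow (Or.inl ha), integral_rpow (Or.inl (by linarith)), ha2, ha1,
    Real.one_rpow, Real.one_rpow, Real.zero_rpow (by positivity), Real.zero_rpow (by positivity)]
  field_simp
  ring

/-- The graph of `y ↦ y ^ s` lies below its tangent line at `m`. -/
theorem rpow_le_tangent {s m y : ℝ} (hs : s ∈ Set.Icc (0 : ℝ) 1) (hm : 0 < m) (hy : 0 ≤ y) :
    y ^ s ≤ m ^ s + m ^ s * (s / m) * (y - m) := by
  have hym : 0 ≤ y / m := div_nonneg hy hm.le
  have h := rpow_one_add_le_one_add_mul_self (s := y / m - 1) (by linarith) hs.1 hs.2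
  rw [add_sub_cancel, Real.div_rpow hy hm.le, div_le_iff₀ (by positivity)] at h
  refine h.trans_eq ?_
  field_simp

/-- Scalar form of the mixed-mean inequality of Theorem 3.9:
`(1-λ) + λx^s ≤ ∫₀¹ ((1-t)+tx)^s dη_λ(t) ≤ ((1-λ)+λx)^s`. -/
theorem stmt_19 (l : ℝ) (hl : l ∈ Set.Ioo (0 : ℝ) 1) (s : ℝ) (hs : s ∈ Set.Icc (0 : ℝ) 1)
    (x : ℝ) (hx : 0 < x) :
    (1 - l) + l * x ^ s ≤
      (∫ t in (0 : ℝ)..1, ((1 - t) + t * x) ^ s *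
        (l / (1 - l) * t ^ ((2 * l - 1) / (1 - l)))) ∧
    (∫ t in (0 : ℝ)..1, ((1 - t) + t * x) ^ s *
        (l / (1 - l) * t ^ ((2 * l - 1) / (1 - l)))) ≤
      ((1 - l) + l * x) ^ s := by
  have h0 : 0 < l := hl.1
  have h1 : 0 < 1 - l := sub_pos.2 hl.2
  have hw := intervalIntegrable_beta_density hl
  have hw0 : ∀ t ∈ Set.Icc (0 : ℝ) 1, 0 ≤ l / (1 - l) * t ^ ((2 * l - 1) / (1 - l)) :=
    fun t ht => mul_nonneg (by positivity) (Real.rpow_nonneg ht.1 _)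
  have hf : IntervalIntegrable (fun t : ℝ => ((1 - t) + t * x) ^ s *
      (l / (1 - l) * t ^ ((2 * l - 1) / (1 - l)))) MeasureTheory.volume 0 1 :=
    hw.continuousOn_mul
      (Continuous.rpow_const (by fun_prop) fun _ => Or.inr hs.1).continuousOn
  have haff : ∀ p q : ℝ, IntervalIntegrable (fun t : ℝ => (p + q * t) *
      (l / (1 - l) * t ^ ((2 * l - 1) / (1 - l)))) MeasureTheory.volume 0 1 :=
    fun p q => hw.continuousOn_mul (by fun_prop)
  constructor
  · calc (1 - l) + l * x ^ s = 1 + (x ^ s - 1) * l := by ring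
      _ = _ := (integral_affine_mul_beta_density hl _ _).symm
      _ ≤ _ := intervalIntegral.integral_mono_on zero_le_one (haff _ _) hf fun t ht =>
        mul_le_mul_of_nonneg_right ?_ (hw0 t ht)
    have h := (Real.concaveOn_rpow hs.1 hs.2).2 (Set.mem_Ici.2 zero_le_one)
      (Set.mem_Ici.2 hx.le) (sub_nonneg.2 ht.2) ht.1 (sub_add_cancel 1 t)
    simp only [smul_eq_mul, mul_one, Real.one_rpow] at h
    linarith
  · have hm : 0 < (1 - l) + l * x := by positivity
    set m := (1 - l) + l * x with hmdef
    set k := m ^ s * (s / m) * (x - 1)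
    calc _ ≤ _ := intervalIntegral.integral_mono_on zero_le_one hf (haff (m ^ s - k * l) k)
          fun t ht => mul_le_mul_of_nonneg_right ?_ (hw0 t ht)
      _ = m ^ s - k * l + k * l := integral_affine_mul_beta_density hl _ _
      _ = m ^ s := sub_add_cancel _ _
    have hy : 0 ≤ (1 - t) + t * x :=
      add_nonneg (sub_nonneg.2 ht.2) (mul_nonneg ht.1 hx.le)
    refine (rpow_le_tangent hs hm hy).trans_eq ?_
    rw [show (1 - t) + t * x - m = (x - 1) * (t - l) by rw [hmdef]; ring]
    ring
end
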